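/- Let (g,c,n) be a v-admissible triplet with g ≥ 5 and 2c ≥ g² - 2g + 4. If g is even, then g/4 ≤ A(g,c,n) ≤ (g+4)/4; if g is odd, then g/4 ≤ A(g,c,n) ≤ (g+5)/4. -/

import Mathlib

open SimpleGraph Set

/-- Auxiliary distance on representations of points of the metric graph:
a point is represented by `(u, v, t)` with `u, v` adjacent and `t ∈ [0,1]`,
meaning the point on the edge `[u,v]` at distance `t` from `u`. -/
noncomputable def mgDistAux {V : Type} [Fintype V] [DecidableEq V] (G : SimpleGraph V)
    (p q : V × V × ℝ) : ℝ :=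
  min
    (min (if p.1 = q.1 ∧ p.2.1 = q.2.1 then |p.2.2 - q.2.2| else (Fintype.card V : ℝ) + 1)
         (if p.1 = q.2.1 ∧ p.2.1 = q.1 then |p.2.2 - (1 - q.2.2)| else (Fintype.card V : ℝ) + 1))
    (min (min (p.2.2 + (G.dist p.1 q.1 : ℝ) + q.2.2)
              (p.2.2 + (G.dist p.1 q.2.1 : ℝ) + (1 - q.2.2)))
         (min ((1 - p.2.2) + (G.dist p.2.1 q.1 : ℝ) + q.2.2)
              ((1 - p.2.2) + (G.dist p.2.1 q.2.1 : ℝ) + (1 - q.2.2))))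

/-- The points of the metric graph associated to a simple graph `G`:
the vertices together with the interior points of the edges. -/
def MGPoint {V : Type} (G : SimpleGraph V) : Type :=
  {p : V × V × ℝ // G.Adj p.1 p.2.1 ∧ p.2.2 ∈ Set.Icc (0 : ℝ) 1}

/-- The shortest-path distance on the metric graph associated to `G`
(every edge has length 1). -/
noncomputable def mgDist {V : Type} [Fintype V] [DecidableEq V] (G : SimpleGraph V)
    (p q : MGPoint G) : ℝ := mgDistAux G p.1 q.1

/-- Distance from a vertex `v` to a point of the metric graph. -/
noncomputable def mgVDist {V : Type} [Fintype V] [DecidableEq V] (G : SimpleGraph V)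
    (v : V) (x : MGPoint G) : ℝ :=
  min ((G.dist v x.1.1 : ℝ) + x.1.2.2) ((G.dist v x.1.2.1 : ℝ) + (1 - x.1.2.2))

/-- `γ` restricted to `[a,b]` is a geodesic in the metric graph of `G`
(an arc-length parametrization realizing distances). -/
def IsMGGeodesic {V : Type} [Fintype V] [DecidableEq V] (G : SimpleGraph V)
    (a b : ℝ) (γ : ℝ → MGPoint G) : Prop :=
  a ≤ b ∧ ∀ s ∈ Set.Icc a b, ∀ t ∈ Set.Icc a b, mgDist G (γ s) (γ t) = |s - t|

/-- A geodesic triangle in the metric graph of `G`: three geodesic sides whose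
endpoints match cyclically (distance `0` means equality of points). -/
structure MGTriangle {V : Type} [Fintype V] [DecidableEq V] (G : SimpleGraph V) where
  a1 : ℝ
  b1 : ℝ
  a2 : ℝ
  b2 : ℝ
  a3 : ℝ
  b3 : ℝ
  g1 : ℝ → MGPoint G
  g2 : ℝ → MGPoint G
  g3 : ℝ → MGPoint G
  h1 : IsMGGeodesic G a1 b1 g1
  h2 : IsMGGeodesic G a2 b2 g2
  h3 : IsMGGeodesic G a3 b3 g3
  glue1 : mgDist G (g1 b1) (g2 a2) = 0
  glue2 : mgDist G (g2 b2) (g3 a3) = 0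
  glue3 : mgDist G (g3 b3) (g1 a1) = 0

/-- The sharp thin constant `δ(T)` of a geodesic triangle: the infimum of the
`d ≥ 0` such that each side is contained in the `d`-neighborhood of the union of
the other two sides. -/
noncomputable def triangleDelta {V : Type} [Fintype V] [DecidableEq V] {G : SimpleGraph V}
    (T : MGTriangle G) : ℝ :=
  sInf {d : ℝ | 0 ≤ d ∧
    (∀ s ∈ Set.Icc T.a1 T.b1,
      (∃ t ∈ Set.Icc T.a2 T.b2, mgDist G (T.g1 s) (T.g2 t) ≤ d) ∨
      (∃ t ∈ Set.Icc T.a3 T.b3, mgDist G (T.g1 s) (T.g3 t) ≤ d)) ∧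
    (∀ s ∈ Set.Icc T.a2 T.b2,
      (∃ t ∈ Set.Icc T.a1 T.b1, mgDist G (T.g2 s) (T.g1 t) ≤ d) ∨
      (∃ t ∈ Set.Icc T.a3 T.b3, mgDist G (T.g2 s) (T.g3 t) ≤ d)) ∧
    (∀ s ∈ Set.Icc T.a3 T.b3,
      (∃ t ∈ Set.Icc T.a1 T.b1, mgDist G (T.g3 s) (T.g1 t) ≤ d) ∨
      (∃ t ∈ Set.Icc T.a2 T.b2, mgDist G (T.g3 s) (T.g2 t) ≤ d))}

/-- The hyperbolicity constant `δ(G)`: the supremum of `δ(T)` over all geodesic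
triangles `T` in the metric graph of `G`. -/
noncomputable def hypDelta {V : Type} [Fintype V] [DecidableEq V] (G : SimpleGraph V) : ℝ :=
  sSup {d : ℝ | ∃ T : MGTriangle G, d = triangleDelta T}

/-- The circumference of `G`: the length of a longest cycle. -/
noncomputable def circumference {V : Type} (G : SimpleGraph V) : ℕ :=
  sSup {n : ℕ | ∃ (a : V) (w : G.Walk a a), w.IsCycle ∧ w.length = n}

/-- `G` belongs to the class `𝒢(g,c,n)` of (connected) graphs with girth `g`,
circumference `c` and `n` vertices (vertex set `Fin n`). -/
def memGclass (g c : ℕ) {n : ℕ} (G : SimpleGraph (Fin n)) : Prop :=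
  G.Connected ∧ G.girth = g ∧ circumference G = c

/-- `A(g,c,n) = min {δ(G) : G ∈ 𝒢(g,c,n)}`. -/
noncomputable def Agcn (g c n : ℕ) : ℝ :=
  sInf {d : ℝ | ∃ G : SimpleGraph (Fin n), memGclass g c G ∧ d = hypDelta G}

/-- `B(g,c,n) = max {δ(G) : G ∈ 𝒢(g,c,n)}`. -/
noncomputable def Bgcn (g c n : ℕ) : ℝ :=
  sSup {d : ℝ | ∃ G : SimpleGraph (Fin n), memGclass g c G ∧ d = hypDelta G}

/-- `G` belongs to the class `ℋ(g,c,m)` of (connected) graphs with girth `g`,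
circumference `c` and `m` edges. -/
def memHclass (g c m : ℕ) {k : ℕ} (G : SimpleGraph (Fin k)) : Prop :=
  G.Connected ∧ G.girth = g ∧ circumference G = c ∧ G.edgeSet.ncard = m

/-- `α(g,c,m) = min {δ(G) : G ∈ ℋ(g,c,m)}`. -/
noncomputable def alphagcm (g c m : ℕ) : ℝ :=
  sInf {d : ℝ | ∃ (k : ℕ) (G : SimpleGraph (Fin k)), memHclass g c m G ∧ d = hypDelta G}

/-- `β(g,c,m) = max {δ(G) : G ∈ ℋ(g,c,m)}`. -/
noncomputable def betagcm (g c m : ℕ) : ℝ :=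
  sSup {d : ℝ | ∃ (k : ℕ) (G : SimpleGraph (Fin k)), memHclass g c m G ∧ d = hypDelta G}

open SimpleGraph Set
set_option linter.unusedSectionVars false

section Basics
variable {V : Type} [Fintype V] [DecidableEq V] {G : SimpleGraph V}

theorem dist_adj_le {G : SimpleGraph V} (hG : G.Connected) {u v : V} (h : G.Adj u v) (w : V) :
    (G.dist w v : ℝ) ≤ G.dist w u + 1 := by
  have h1 := hG.dist_triangle (u := w) (v := u) (w := v)
  have h2 : G.dist u v = 1 := SimpleGraph.dist_eq_one_iff_adj.2 h
  rw [h2] at h1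
  exact_mod_cast h1

theorem dist_tri {G : SimpleGraph V} (hG : G.Connected) (u v w : V) :
    (G.dist u w : ℝ) ≤ G.dist u v + G.dist v w := by
  exact_mod_cast hG.dist_triangle (u := u) (v := v) (w := w)

theorem dist_card {G : SimpleGraph V} (hG : G.Connected) (u v : V) :
    (G.dist u v : ℝ) + 1 ≤ Fintype.card V := by
  obtain ⟨p, hp, hl⟩ := hG.exists_path_of_dist u v
  have := hp.length_lt
  rw [hl] at this
  exact_mod_cast this

theorem mgVDist_le_u (v : V) (x : MGPoint G) : mgVDist G v x ≤ G.dist v x.1.1 + x.1.2.2 :=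
  min_le_left _ _
theorem mgVDist_le_v (v : V) (x : MGPoint G) :
    mgVDist G v x ≤ G.dist v x.1.2.1 + (1 - x.1.2.2) :=
  min_le_right _ _
theorem mgVDist_cases (v : V) (x : MGPoint G) :
    mgVDist G v x = G.dist v x.1.1 + x.1.2.2 ∨ mgVDist G v x = G.dist v x.1.2.1 + (1 - x.1.2.2) :=
  min_choice _ _

theorem mgVDist_nonneg (v : V) (x : MGPoint G) : 0 ≤ mgVDist G v x := by
  have h0 := x.2.2.1
  have h1 := x.2.2.2
  rcases mgVDist_cases v x with h | h <;> rw [h] <;>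
    [exact add_nonneg (by positivity) h0; exact add_nonneg (by positivity) (by linarith)]

theorem mgDist_comm (p q : MGPoint G) : mgDist G p q = mgDist G q p := by
  have e1 : (if p.1.1 = q.1.1 ∧ p.1.2.1 = q.1.2.1 then |p.1.2.2 - q.1.2.2|
      else (Fintype.card V : ℝ) + 1) =
      (if q.1.1 = p.1.1 ∧ q.1.2.1 = p.1.2.1 then |q.1.2.2 - p.1.2.2|
      else (Fintype.card V : ℝ) + 1) := by
    rw [abs_sub_comm]
    exact if_congr (and_congr eq_comm eq_comm) rfl rfl
  have e2 : (if p.1.1 = q.1.2.1 ∧ p.1.2.1 = q.1.1 then |p.1.2.2 - (1 - q.1.2.2)|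
      else (Fintype.card V : ℝ) + 1) =
      (if q.1.1 = p.1.2.1 ∧ q.1.2.1 = p.1.1 then |q.1.2.2 - (1 - p.1.2.2)|
      else (Fintype.card V : ℝ) + 1) := by
    have : |p.1.2.2 - (1 - q.1.2.2)| = |q.1.2.2 - (1 - p.1.2.2)| := by congr 1; ring
    rw [this]
    exact if_congr (and_comm.trans (and_congr eq_comm eq_comm)) rfl rfl
  unfold mgDist mgDistAux
  rw [e1, e2, SimpleGraph.dist_comm (u := p.1.1) (v := q.1.1), SimpleGraph.dist_comm (u := p.1.1) (v := q.1.2.1),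
    SimpleGraph.dist_comm (u := p.1.2.1) (v := q.1.1), SimpleGraph.dist_comm (u := p.1.2.1) (v := q.1.2.1)]
  congr 1
  rw [min_min_min_comm]
  congr 1 <;> congr 1 <;> ring

theorem mgDist_le_u (p q : MGPoint G) : mgDist G p q ≤ p.1.2.2 + mgVDist G p.1.1 q := by
  rcases mgVDist_cases p.1.1 q with h | h <;> rw [h] <;> unfold mgDist mgDistAux
  · refine (min_le_right _ _).trans ((min_le_left _ _).trans ((min_le_left _ _).trans ?_)); linarith
  · refine (min_le_right _ _).trans ((min_le_left _ _).trans ((min_le_right _ _).trans ?_)); linarith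

theorem mgDist_le_v (p q : MGPoint G) : mgDist G p q ≤ (1 - p.1.2.2) + mgVDist G p.1.2.1 q := by
  rcases mgVDist_cases p.1.2.1 q with h | h <;> rw [h] <;> unfold mgDist mgDistAux
  · refine (min_le_right _ _).trans ((min_le_right _ _).trans ((min_le_left _ _).trans ?_)); linarith
  · refine (min_le_right _ _).trans ((min_le_right _ _).trans ((min_le_right _ _).trans ?_)); linarith

theorem mgDist_le_same (p q : MGPoint G) (h1 : p.1.1 = q.1.1) (h2 : p.1.2.1 = q.1.2.1) :
    mgDist G p q ≤ |p.1.2.2 - q.1.2.2| := by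
  unfold mgDist mgDistAux
  refine (min_le_left _ _).trans ((min_le_left _ _).trans ?_)
  rw [if_pos ⟨h1, h2⟩]

theorem mgDist_le_flip (p q : MGPoint G) (h1 : p.1.1 = q.1.2.1) (h2 : p.1.2.1 = q.1.1) :
    mgDist G p q ≤ |p.1.2.2 - (1 - q.1.2.2)| := by
  unfold mgDist mgDistAux
  refine (min_le_left _ _).trans ((min_le_right _ _).trans ?_)
  rw [if_pos ⟨h1, h2⟩]

theorem mgDist_cases (hG : G.Connected) (p q : MGPoint G) :
    mgDist G p q = p.1.2.2 + mgVDist G p.1.1 q ∨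
    mgDist G p q = (1 - p.1.2.2) + mgVDist G p.1.2.1 q ∨
    (p.1.1 = q.1.1 ∧ p.1.2.1 = q.1.2.1 ∧ mgDist G p q = |p.1.2.2 - q.1.2.2|) ∨
    (p.1.1 = q.1.2.1 ∧ p.1.2.1 = q.1.1 ∧ mgDist G p q = |p.1.2.2 - (1 - q.1.2.2)|) := by
  have hu := mgDist_le_u p q
  have hv := mgDist_le_v p q
  have h1 := mgVDist_le_u p.1.1 q
  have h2 := mgVDist_le_v p.1.1 q
  have h3 := mgVDist_le_u p.1.2.1 q
  have h4 := mgVDist_le_v p.1.2.1 q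
  have hp0 := p.2.2.1
  have hp1 := p.2.2.2
  have hq0 := q.2.2.1
  have hq1 := q.2.2.2
  have hc := dist_card hG p.1.1 q.1.1
  have hbig : mgDist G p q = (Fintype.card V : ℝ) + 1 →
      mgDist G p q = p.1.2.2 + mgVDist G p.1.1 q := by
    intro h; linarith
  have key : mgDist G p q = mgDistAux G p.1 q.1 := rfl
  unfold mgDistAux at key
  rcases min_choice (min (if p.1.1 = q.1.1 ∧ p.1.2.1 = q.1.2.1 then |p.1.2.2 - q.1.2.2|
      else (Fintype.card V : ℝ) + 1) (if p.1.1 = q.1.2.1 ∧ p.1.2.1 = q.1.1 then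
      |p.1.2.2 - (1 - q.1.2.2)| else (Fintype.card V : ℝ) + 1))
    (min (min (p.1.2.2 + (G.dist p.1.1 q.1.1 : ℝ) + q.1.2.2)
              (p.1.2.2 + (G.dist p.1.1 q.1.2.1 : ℝ) + (1 - q.1.2.2)))
         (min ((1 - p.1.2.2) + (G.dist p.1.2.1 q.1.1 : ℝ) + q.1.2.2)
              ((1 - p.1.2.2) + (G.dist p.1.2.1 q.1.2.1 : ℝ) + (1 - q.1.2.2)))) with h | h
  · rw [h] at key
    rcases min_choice (if p.1.1 = q.1.1 ∧ p.1.2.1 = q.1.2.1 then |p.1.2.2 - q.1.2.2|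
      else (Fintype.card V : ℝ) + 1) (if p.1.1 = q.1.2.1 ∧ p.1.2.1 = q.1.1 then
      |p.1.2.2 - (1 - q.1.2.2)| else (Fintype.card V : ℝ) + 1) with h' | h'
    · rw [h'] at key
      split_ifs at key with hh
      · exact Or.inr (Or.inr (Or.inl ⟨hh.1, hh.2, key⟩))
      · exact Or.inl (hbig key)
    · rw [h'] at key
      split_ifs at key with hh
      · exact Or.inr (Or.inr (Or.inr ⟨hh.1, hh.2, key⟩))
      · exact Or.inl (hbig key)
  · rw [h] at key
    rcases min_choice (min (p.1.2.2 + (G.dist p.1.1 q.1.1 : ℝ) + q.1.2.2)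
              (p.1.2.2 + (G.dist p.1.1 q.1.2.1 : ℝ) + (1 - q.1.2.2)))
         (min ((1 - p.1.2.2) + (G.dist p.1.2.1 q.1.1 : ℝ) + q.1.2.2)
              ((1 - p.1.2.2) + (G.dist p.1.2.1 q.1.2.1 : ℝ) + (1 - q.1.2.2))) with h' | h'
    · rw [h'] at key
      left
      rcases min_choice (p.1.2.2 + (G.dist p.1.1 q.1.1 : ℝ) + q.1.2.2)
              (p.1.2.2 + (G.dist p.1.1 q.1.2.1 : ℝ) + (1 - q.1.2.2)) with h'' | h'' <;>
        rw [h''] at key <;> linarith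
    · rw [h'] at key
      right; left
      rcases min_choice ((1 - p.1.2.2) + (G.dist p.1.2.1 q.1.1 : ℝ) + q.1.2.2)
              ((1 - p.1.2.2) + (G.dist p.1.2.1 q.1.2.1 : ℝ) + (1 - q.1.2.2)) with h'' | h'' <;>
        rw [h''] at key <;> linarith

theorem mgVDist_dist (hG : G.Connected) (u v : V) (p : MGPoint G) :
    mgVDist G u p ≤ G.dist u v + mgVDist G v p := by
  have h1 := mgVDist_le_u u p
  have h2 := mgVDist_le_v u p
  rcases mgVDist_cases v p with h | h
  · have := dist_tri hG u v p.1.1; linarith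
  · have := dist_tri hG u v p.1.2.1; linarith

theorem mgVDist_tri (hG : G.Connected) (v : V) (p q : MGPoint G) :
    mgVDist G v p ≤ mgVDist G v q + mgDist G q p := by
  have hp0 := p.2.2.1
  have hp1 := p.2.2.2
  have hq0 := q.2.2.1
  have hq1 := q.2.2.2
  have a1 := dist_adj_le hG q.2.1 v
  have a2 := dist_adj_le hG q.2.1.symm v
  have b1 := mgVDist_dist hG v q.1.1 p
  have b2 := mgVDist_dist hG v q.1.2.1 p
  have c1 := mgVDist_le_u v p
  have c2 := mgVDist_le_v v p
  rcases mgDist_cases hG q p with h | h | ⟨e1, e2, h⟩ | ⟨e1, e2, h⟩ <;>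
    rcases mgVDist_cases v q with h' | h' <;> rw [h, h']
  · linarith
  · linarith
  · linarith
  · linarith
  · rw [e1]; have := neg_abs_le (q.1.2.2 - p.1.2.2); linarith
  · rw [e2]; have := le_abs_self (q.1.2.2 - p.1.2.2); linarith
  · rw [e1]; have := neg_abs_le (q.1.2.2 - (1 - p.1.2.2)); linarith
  · rw [e2]; have := le_abs_self (q.1.2.2 - (1 - p.1.2.2)); linarith

theorem mgDist_tri (hG : G.Connected) (p q r : MGPoint G) :
    mgDist G p r ≤ mgDist G p q + mgDist G q r := by
  rcases mgDist_cases hG p q with h | h | ⟨e1, e2, h⟩ | ⟨e1, e2, h⟩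
  · have := mgDist_le_u p r
    have := mgVDist_tri hG p.1.1 r q
    linarith
  · have := mgDist_le_v p r
    have := mgVDist_tri hG p.1.2.1 r q
    linarith
  all_goals
    rw [mgDist_comm q r, mgDist_comm p r, mgDist_comm p q]
    rcases mgDist_cases hG r q with h' | h' | ⟨e1', e2', h'⟩ | ⟨e1', e2', h'⟩
    · have := mgDist_le_u r p
      have := mgVDist_tri hG r.1.1 p q
      linarith
    · have := mgDist_le_v r p
      have := mgVDist_tri hG r.1.2.1 p q
      linarith
  · have := mgDist_le_same r p (e1'.trans e1.symm) (e2'.trans e2.symm)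
    rw [h', mgDist_comm q p, h]
    have := abs_sub_le r.1.2.2 q.1.2.2 p.1.2.2
    rw [abs_sub_comm q.1.2.2] at this
    linarith
  · have := mgDist_le_flip r p (e1'.trans e2.symm) (e2'.trans e1.symm)
    rw [h', mgDist_comm q p, h]
    have := abs_sub_le r.1.2.2 (1 - q.1.2.2) (1 - p.1.2.2)
    rw [show (1 - q.1.2.2) - (1 - p.1.2.2) = p.1.2.2 - q.1.2.2 by ring] at this
    linarith
  · have := mgDist_le_flip r p (e1'.trans e2.symm) (e2'.trans e1.symm)
    rw [h', mgDist_comm q p, h]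
    have := abs_sub_le r.1.2.2 q.1.2.2 (1 - p.1.2.2)
    rw [show q.1.2.2 - (1 - p.1.2.2) = p.1.2.2 - (1 - q.1.2.2) by ring] at this
    linarith
  · have := mgDist_le_same r p (e1'.trans e1.symm) (e2'.trans e2.symm)
    rw [h', mgDist_comm q p, h]
    have := abs_sub_le r.1.2.2 (1 - q.1.2.2) p.1.2.2
    rw [abs_sub_comm (1 - q.1.2.2)] at this
    linarith

theorem mgDist_nonneg (hG : G.Connected) (p q : MGPoint G) : 0 ≤ mgDist G p q := by
  have hp0 := p.2.2.1
  have hp1 := p.2.2.2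
  have := mgVDist_nonneg p.1.1 q
  have := mgVDist_nonneg p.1.2.1 q
  rcases mgDist_cases hG p q with h | h | ⟨e1, e2, h⟩ | ⟨e1, e2, h⟩ <;> rw [h]
  · linarith
  · linarith
  · positivity
  · positivity

theorem mgDist_bdd (hG : G.Connected) (p q : MGPoint G) : mgDist G p q ≤ Fintype.card V + 1 := by
  have := mgDist_le_u p q
  have := mgVDist_le_u p.1.1 q
  have := dist_card hG p.1.1 q.1.1
  have hp1 := p.2.2.2
  have hq1 := q.2.2.2
  linarith

/-- Linear extension of a vertex function. -/
noncomputable def mgExt (F : V → ℝ) (p : MGPoint G) : ℝ := (1 - p.1.2.2) * F p.1.1 + p.1.2.2 * F p.1.2.1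

theorem lip_dist (hG : G.Connected) {F : V → ℝ} (hF : ∀ u v, G.Adj u v → |F u - F v| ≤ 1) (u v : V) :
    |F u - F v| ≤ G.dist u v := by
  obtain ⟨w, hw⟩ := hG.exists_walk_length_eq_dist u v
  rw [← hw]
  clear hw
  induction w with
  | nil => simp
  | cons h p ih =>
    rename_i a b c
    have := hF _ _ h
    have := abs_sub_le (F a) (F b) (F c)
    push_cast [Walk.length_cons]
    linarith

theorem lip_v (hG : G.Connected) {F : V → ℝ} (hF : ∀ u v, G.Adj u v → |F u - F v| ≤ 1) (u : V)
    (p : MGPoint G) : |F u - mgExt F p| ≤ mgVDist G u p := by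
  have hp0 := p.2.2.1
  have hp1 := p.2.2.2
  have h1 := abs_le.1 (lip_dist hG hF u p.1.1)
  have h2 := abs_le.1 (lip_dist hG hF u p.1.2.1)
  have h3 := abs_le.1 (hF _ _ p.2.1)
  unfold mgExt
  rcases mgVDist_cases u p with h | h <;> rw [h, abs_le] <;> constructor <;> nlinarith

theorem lip_mg (hG : G.Connected) {F : V → ℝ} (hF : ∀ u v, G.Adj u v → |F u - F v| ≤ 1)
    (p q : MGPoint G) : |mgExt F p - mgExt F q| ≤ mgDist G p q := by
  have hp0 := p.2.2.1
  have hp1 := p.2.2.2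
  have h1 := abs_le.1 (lip_v hG hF p.1.1 q)
  have h2 := abs_le.1 (lip_v hG hF p.1.2.1 q)
  have h3 := abs_le.1 (hF _ _ p.2.1)
  have hpd : mgExt F p = (1 - p.1.2.2) * F p.1.1 + p.1.2.2 * F p.1.2.1 := rfl
  rcases mgDist_cases hG p q with h | h | ⟨e1, e2, h⟩ | ⟨e1, e2, h⟩
  · rw [h, abs_le]; constructor <;> nlinarith
  · rw [h, abs_le]; constructor <;> nlinarith
  · have : mgExt F p - mgExt F q = (p.1.2.2 - q.1.2.2) * (F p.1.2.1 - F p.1.1) := by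
      unfold mgExt; rw [← e1, ← e2]; ring
    rw [this, h, abs_mul]
    have := hF _ _ p.2.1.symm
    nlinarith [abs_nonneg (p.1.2.2 - q.1.2.2)]
  · have : mgExt F p - mgExt F q = (p.1.2.2 - (1 - q.1.2.2)) * (F p.1.2.1 - F p.1.1) := by
      unfold mgExt; rw [← e1, ← e2]; ring
    rw [this, h, abs_mul]
    have := hF _ _ p.2.1.symm
    nlinarith [abs_nonneg (p.1.2.2 - (1 - q.1.2.2))]

theorem geo_ivt (hG : G.Connected) {F : V → ℝ} (hF : ∀ u v, G.Adj u v → |F u - F v| ≤ 1)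
    {a b : ℝ} {γ : ℝ → MGPoint G} (hγ : IsMGGeodesic G a b γ) {s t : ℝ} (hs : s ∈ Icc a b)
    (ht : t ∈ Icc a b) (h1 : mgExt F (γ s) ≤ 0) (h2 : 0 ≤ mgExt F (γ t)) :
    ∃ r ∈ uIcc s t, r ∈ Icc a b ∧ mgExt F (γ r) = 0 := by
  have hcont : ContinuousOn (fun r => mgExt F (γ r)) (Icc a b) := by
    have : LipschitzOnWith 1 (fun r => mgExt F (γ r)) (Icc a b) := by
      apply LipschitzOnWith.of_dist_le_mul
      intro x hx y hy
      rw [Real.dist_eq, Real.dist_eq, ← hγ.2 x hx y hy]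
      simpa using lip_mg hG hF (γ x) (γ y)
    exact this.continuousOn
  have hsub : uIcc s t ⊆ Icc a b := by
    intro r hr
    rw [mem_uIcc] at hr
    rcases hr with hr | hr
    · exact ⟨hs.1.trans hr.1, hr.2.trans ht.2⟩
    · exact ⟨ht.1.trans hr.1, hr.2.trans hs.2⟩
  have := intermediate_value_uIcc (hcont.mono hsub)
  have h0 : (0 : ℝ) ∈ uIcc (mgExt F (γ s)) (mgExt F (γ t)) := by
    rw [mem_uIcc]; exact Or.inl ⟨h1, h2⟩
  obtain ⟨r, hr, hr0⟩ := this h0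
  exact ⟨r, hr, hsub hr, hr0⟩

end Basics

open SimpleGraph Set
set_option linter.unusedSectionVars false

section Seqs
variable {V : Type} [Fintype V] [DecidableEq V] {G : SimpleGraph V}

theorem seq_walk {c : ℕ → V} (hc : ∀ k, G.Adj (c k) (c (k + 1))) (i n : ℕ) :
    ∃ w : G.Walk (c i) (c (i + n)), w.length = n ∧ w.support = (List.range' i (n + 1)).map c := by
  induction n with
  | zero => exact ⟨Walk.nil, by simp, by simp⟩
  | succ n ih =>
    obtain ⟨w, h1, h2⟩ := ih
    refine ⟨w.concat (hc (i + n)), by simp [h1], ?_⟩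
    rw [Walk.support_concat, h2, List.range'_concat (n := n + 1)]
    simp

theorem seq_dist {c : ℕ → V} (hc : ∀ k, G.Adj (c k) (c (k + 1))) {i j : ℕ} (h : i ≤ j) :
    (G.dist (c i) (c j) : ℝ) ≤ (j : ℝ) - i := by
  obtain ⟨n, rfl⟩ := Nat.exists_eq_add_of_le h
  obtain ⟨w, hw, -⟩ := seq_walk hc i n
  have := SimpleGraph.dist_le w
  rw [hw] at this
  push_cast
  have : (G.dist (c i) (c (i + n)) : ℝ) ≤ n := by exact_mod_cast this
  linarith

/-- A closed simple sequence of period `f`. -/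
def CycSeq (G : SimpleGraph V) (f : ℕ) (c : ℕ → V) : Prop :=
  (∀ k, G.Adj (c k) (c (k + 1))) ∧ (∀ k, c (k + f) = c k) ∧ ∀ i j, i < j → j < i + f → c i ≠ c j

theorem CycSeq.path {f : ℕ} {c : ℕ → V} (h : CycSeq G f c) (i n : ℕ) (hn : n < f) :
    ∃ w : G.Walk (c i) (c (i + n)), w.length = n ∧ w.IsPath := by
  obtain ⟨w, h1, h2⟩ := seq_walk h.1 i n
  refine ⟨w, h1, ?_⟩
  rw [Walk.isPath_def, h2]
  refine List.Nodup.map_on ?_ List.nodup_range'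
  intro x hx y hy hxy
  rw [List.mem_range'_1] at hx hy
  rcases lt_trichotomy x y with hh | hh | hh
  · exact absurd hxy (h.2.2 x y hh (by omega))
  · exact hh
  · exact absurd hxy.symm (h.2.2 y x hh (by omega))

theorem path_end_edge {u v : V} (w : G.Walk u v) (hp : w.IsPath) (h2 : 2 ≤ w.length) :
    s(v, u) ∉ w.edges := by
  intro hmem
  rw [Sym2.eq_swap] at hmem
  cases w with
  | nil => simp at h2
  | cons ha q =>
    rw [Walk.edges_cons, List.mem_cons] at hmem
    rw [Walk.cons_isPath_iff] at hp
    rcases hmem with hm | hm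
    · rw [Sym2.eq_iff] at hm
      rcases hm with ⟨-, hm⟩ | ⟨hm, hm'⟩
      · subst hm
        have h0 := (Walk.isPath_iff_nil.1 hp.1).eq_nil
        rw [h0] at h2
        simp at h2
      · exact ha.ne hm
    · exact hp.2 (Walk.fst_mem_support_of_mem_edges _ hm)

theorem CycSeq.cycle {f : ℕ} {c : ℕ → V} (h : CycSeq G f c) (hf : 3 ≤ f) :
    ∃ (a : V) (w : G.Walk a a), w.IsCycle ∧ w.length = f := by
  obtain ⟨w, h1, h2⟩ := seq_walk h.1 0 (f - 1)
  obtain ⟨w', h1', hp⟩ := h.path 0 (f - 1) (by omega)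
  have hadj : G.Adj (c (0 + (f - 1))) (c 0) := by
    have := h.1 (f - 1)
    rw [Nat.sub_add_cancel (by omega), ← zero_add f, h.2.1 0] at this
    simpa using this
  refine ⟨_, Walk.cons hadj w', ?_, by simp [h1']; omega⟩
  rw [Walk.cons_isCycle_iff]
  refine ⟨hp, fun hmem => ?_⟩
  exact path_end_edge w' hp (by omega) hmem

theorem cycle_seq {a : V} {w : G.Walk a a} (hw : w.IsCycle) : ∃ c, CycSeq G w.length c := by
  have h3 := hw.three_le_length
  have hinj := hw.getVert_injOn'
  refine ⟨fun k => w.getVert (k % w.length), ?_, ?_, ?_⟩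
  · intro k
    have hlt := Nat.mod_lt k (show 0 < w.length by omega)
    rcases Nat.lt_or_ge (k % w.length + 1) w.length with hh | hh
    · have : (k + 1) % w.length = k % w.length + 1 := by
        rw [Nat.add_mod, Nat.mod_eq_of_lt (a := 1) (by omega), Nat.mod_eq_of_lt hh]
      simp only [this]
      exact w.adj_getVert_succ hlt
    · have he : k % w.length + 1 = w.length := by omega
      have : (k + 1) % w.length = 0 := by
        rw [Nat.add_mod, Nat.mod_eq_of_lt (a := 1) (by omega), he, Nat.mod_self]
      simp only [this]
      have := w.adj_getVert_succ hlt
      rw [he, Walk.getVert_length] at this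
      simpa using this
  · intro k; simp
  · intro i j hij hj he
    have h1 := Nat.mod_lt i (show 0 < w.length by omega)
    have h2 := Nat.mod_lt j (show 0 < w.length by omega)
    have := hinj (show i % w.length ≤ w.length - 1 by omega)
      (show j % w.length ≤ w.length - 1 by omega) he
    have hm : i ≡ j [MOD w.length] := this
    have := (Nat.modEq_iff_dvd' hij.le).1 hm
    have := Nat.le_of_dvd (by omega) this
    omega

theorem two_paths {u v : V} {p q : G.Walk u v} (hp : p.IsPath) (hq : q.IsPath) (hne : p ≠ q) :
    G.girth ≤ p.length + q.length := by
  classical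
  set H : SimpleGraph V := fromEdgeSet {e | e ∈ p.edges ∨ e ∈ q.edges} with hH
  have hsub : ∀ e ∈ H.edgeSet, e ∈ p.edges ∨ e ∈ q.edges := by
    intro e he
    rw [hH, edgeSet_fromEdgeSet] at he
    exact he.1
  have hpH : ∀ e ∈ p.edges, e ∈ H.edgeSet := by
    intro e he
    rw [hH, edgeSet_fromEdgeSet]
    exact ⟨Or.inl he, G.not_isDiag_of_mem_edgeSet (p.edges_subset_edgeSet he)⟩
  have hqH : ∀ e ∈ q.edges, e ∈ H.edgeSet := by
    intro e he
    rw [hH, edgeSet_fromEdgeSet]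
    exact ⟨Or.inr he, G.not_isDiag_of_mem_edgeSet (q.edges_subset_edgeSet he)⟩
  have hac : ¬ H.IsAcyclic := by
    intro hac
    have := (hac.subsingleton_path u v).elim ⟨p.transfer H hpH, hp.transfer hpH⟩
      ⟨q.transfer H hqH, hq.transfer hqH⟩
    have h2 : p.transfer H hpH = q.transfer H hqH := congrArg Subtype.val this
    have h3 : p.support = q.support := by
      rw [← Walk.support_transfer p hpH, h2, Walk.support_transfer]
    exact hne (Walk.ext_support h3)
  obtain ⟨a, w, hw, hwl⟩ := exists_girth_eq_length.2 hac
  have hwG : ∀ e ∈ w.edges, e ∈ G.edgeSet := by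
    intro e he
    rcases hsub e (w.edges_subset_edgeSet he) with h | h
    · exact p.edges_subset_edgeSet h
    · exact q.edges_subset_edgeSet h
  have h1 := girth_le_length (hw.transfer hwG)
  rw [Walk.length_transfer] at h1
  refine h1.trans ?_
  rw [← Walk.length_edges w, ← Walk.length_edges p, ← Walk.length_edges q, ← List.length_append]
  apply List.Subperm.length_le
  apply List.Nodup.subperm hw.isCircuit.isTrail.edges_nodup
  intro e he
  rw [List.mem_append]
  exact hsub e (w.edges_subset_edgeSet he)

theorem CycSeq.dist_ge (hG : G.Connected) {f : ℕ} {c : ℕ → V} (h : CycSeq G f c)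
    (hgirth : G.girth = f) {i j : ℕ} (hij : i ≤ j) :
    ((j : ℝ) - i ≤ G.dist (c i) (c j)) ∨ ((f : ℝ) - ((j : ℝ) - i) ≤ G.dist (c i) (c j)) := by
  by_contra hcon
  push Not at hcon
  obtain ⟨n, rfl⟩ := Nat.exists_eq_add_of_le hij
  obtain ⟨h1, h2⟩ := hcon
  push_cast at h1 h2
  have hd0 : (0 : ℝ) ≤ G.dist (c i) (c (i + n)) := by positivity
  have h1' : G.dist (c i) (c (i + n)) < n := by
    have : (G.dist (c i) (c (i + n)) : ℝ) < n := by linarith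
    exact_mod_cast this
  have h2' : G.dist (c i) (c (i + n)) + n < f := by
    have : (G.dist (c i) (c (i + n)) : ℝ) + n < f := by linarith
    exact_mod_cast this
  obtain ⟨w, hwl, hwp⟩ := h.path i n (by omega)
  obtain ⟨p, hp, hpl⟩ := hG.exists_path_of_dist (c i) (c (i + n))
  have := two_paths hp hwp (by rintro rfl; omega)
  omega

/-- points on a sequence -/
def cpt {c : ℕ → V} (hc : ∀ k, G.Adj (c k) (c (k + 1))) (k : ℕ) (t : ℝ) (ht : t ∈ Icc (0 : ℝ) 1) :
    MGPoint G := ⟨(c k, c (k + 1), t), hc k, ht⟩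

theorem cpt_dist_le {c : ℕ → V} (hc : ∀ k, G.Adj (c k) (c (k + 1))) {k l : ℕ} {t s : ℝ}
    (ht : t ∈ Icc (0 : ℝ) 1) (hs : s ∈ Icc (0 : ℝ) 1) :
    mgDist G (cpt hc k t ht) (cpt hc l s hs) ≤ |((k : ℝ) + t) - (l + s)| := by
  wlog hkl : k ≤ l generalizing k l t s
  · rw [mgDist_comm, abs_sub_comm]
    exact this hs ht (by omega)
  rcases hkl.lt_or_eq with hlt | rfl
  · have h1 := mgDist_le_v (cpt hc k t ht) (cpt hc l s hs)
    have h2 := mgVDist_le_u (cpt hc k t ht).1.2.1 (cpt hc l s hs)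
    have h3 := seq_dist hc (show k + 1 ≤ l by omega)
    simp only [cpt] at h1 h2
    push_cast at h3
    have := neg_abs_le (((k : ℝ) + t) - (l + s))
    simp only [cpt]
    linarith
  · have := mgDist_le_same (cpt hc k t ht) (cpt hc k s hs) rfl rfl
    simpa [cpt] using this

theorem cpt_per {f : ℕ} {c : ℕ → V} (h : CycSeq G f c) (k : ℕ) (t : ℝ) (ht : t ∈ Icc (0 : ℝ) 1) :
    cpt h.1 (k + f) t ht = cpt h.1 k t ht := by
  unfold cpt
  apply Subtype.ext
  simp only
  rw [h.2.1 k, add_right_comm, h.2.1 (k + 1)]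

theorem cpt_dist_le' {f : ℕ} {c : ℕ → V} (h : CycSeq G f c) {k l : ℕ} {t s : ℝ}
    (ht : t ∈ Icc (0 : ℝ) 1) (hs : s ∈ Icc (0 : ℝ) 1) :
    mgDist G (cpt h.1 k t ht) (cpt h.1 l s hs) ≤ |((k : ℝ) + f + t) - (l + s)| := by
  rw [← cpt_per h k t ht]
  have := cpt_dist_le h.1 (k := k + f) (l := l) ht hs
  push_cast at this
  exact this

theorem cpt_diam {f : ℕ} {c : ℕ → V} (h : CycSeq G f c) {k l : ℕ} (hk : k < f) (hl : l < f)
    {t s : ℝ} (ht : t ∈ Icc (0 : ℝ) 1) (hs : s ∈ Icc (0 : ℝ) 1) :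
    mgDist G (cpt h.1 k t ht) (cpt h.1 l s hs) ≤ f / 2 := by
  wlog hkl : (k : ℝ) + t ≤ l + s generalizing k l t s
  · rw [mgDist_comm]
    exact this hl hk hs ht (by linarith)
  have h1 := cpt_dist_le h.1 (k := k) (l := l) ht hs
  have h2 := cpt_dist_le' h (k := k) (l := l) ht hs
  rw [abs_of_nonpos (by linarith)] at h1
  rw [abs_of_nonneg] at h2
  · linarith
  · have : (l : ℝ) + 1 ≤ f := by exact_mod_cast hl
    have := ht.1
    have := hs.2
    have : (0 : ℝ) ≤ k := by positivity
    linarith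

theorem cpt_dist_ge (hG : G.Connected) {f : ℕ} (hf : 3 ≤ f) {c : ℕ → V} (h : CycSeq G f c)
    (hgirth : G.girth = f) {k l : ℕ} (hkl : k ≤ l) (hl : l ≤ k + f)
    {t s : ℝ} (ht : t ∈ Icc (0 : ℝ) 1) (hs : s ∈ Icc (0 : ℝ) 1) :
    |((k : ℝ) + t) - (l + s)| ≤ mgDist G (cpt h.1 k t ht) (cpt h.1 l s hs) ∨
    f - |((k : ℝ) + t) - (l + s)| ≤ mgDist G (cpt h.1 k t ht) (cpt h.1 l s hs) := by
  have habs : |((k : ℝ) + t) - (l + s)| = (k + t) - (l + s) ∧ k = l ∧ s ≤ t ∨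
      |((k : ℝ) + t) - (l + s)| = (l + s) - (k + t) := by
    rcases le_total ((k : ℝ) + t) (l + s) with hh | hh
    · right; rw [abs_of_nonpos (by linarith)]; ring
    · rcases hkl.lt_or_eq with hlt | rfl
      · have : (k : ℝ) + 1 ≤ l := by exact_mod_cast hlt
        right; rw [abs_of_nonpos]
        · ring
        · linarith [ht.2, hs.1]
      · left; rw [abs_of_nonneg (by linarith)]; exact ⟨rfl, rfl, by linarith⟩
  have e1 := h.dist_ge hG hgirth hkl
  have e2 := h.dist_ge hG hgirth (show k ≤ l + 1 by omega)
  have e4 := h.dist_ge hG hgirth (show k + 1 ≤ l + 1 by omega)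
  have e3 : ((l : ℝ) - (k + 1) ≤ G.dist (c (k + 1)) (c l)) ∨
    ((f : ℝ) - ((l : ℝ) - (k + 1)) ≤ G.dist (c (k + 1)) (c l)) := by
    rcases hkl.lt_or_eq with hlt | rfl
    · have := h.dist_ge hG hgirth (show k + 1 ≤ l by omega)
      push_cast at this
      exact this
    · left
      have : (0 : ℝ) ≤ G.dist (c (k + 1)) (c k) := by positivity
      linarith
  have e3' : k = l → (G.dist (c (k + 1)) (c l) : ℝ) = 1 := by
    rintro rfl
    exact_mod_cast SimpleGraph.dist_eq_one_iff_adj.2 (h.1 k).symm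
  obtain ⟨ht0, ht1⟩ := ht
  obtain ⟨hs0, hs1⟩ := hs
  have n1 : (0 : ℝ) ≤ G.dist (c k) (c l) := by positivity
  have n2 : (0 : ℝ) ≤ G.dist (c k) (c (l + 1)) := by positivity
  have n3 : (0 : ℝ) ≤ G.dist (c (k + 1)) (c l) := by positivity
  have n4 : (0 : ℝ) ≤ G.dist (c (k + 1)) (c (l + 1)) := by positivity
  push_cast at e1 e2 e4
  rcases mgDist_cases hG (cpt h.1 k t ⟨ht0, ht1⟩) (cpt h.1 l s ⟨hs0, hs1⟩) with
    hh | hh | ⟨a1, a2, hh⟩ | ⟨a1, a2, hh⟩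
  · rcases mgVDist_cases (cpt h.1 k t ⟨ht0, ht1⟩).1.1 (cpt h.1 l s ⟨hs0, hs1⟩) with h' | h' <;>
      rw [hh, h'] <;> simp only [cpt]
    · rcases habs with ⟨ha, rfl, hle⟩ | ha <;> rw [ha]
      · left; linarith
      · rcases e1 with e1 | e1 <;> [left; right] <;> linarith
    · rcases habs with ⟨ha, rfl, hle⟩ | ha <;> rw [ha]
      · left; linarith
      · rcases e2 with e1 | e1 <;> [left; right] <;> linarith
  · rcases mgVDist_cases (cpt h.1 k t ⟨ht0, ht1⟩).1.2.1 (cpt h.1 l s ⟨hs0, hs1⟩) with h' | h' <;>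
      rw [hh, h'] <;> simp only [cpt]
    · rcases habs with ⟨ha, rfl, hle⟩ | ha <;> rw [ha]
      · left
        have := e3' rfl
        linarith
      · rcases e3 with e1 | e1 <;> [left; right] <;> linarith
    · rcases habs with ⟨ha, rfl, hle⟩ | ha <;> rw [ha]
      · left
        have := h.1 k
        have : (G.dist (c (k + 1)) (c (k + 1)) : ℝ) = 0 := by simp
        have hf' : (3 : ℝ) ≤ f := by exact_mod_cast hf
        have e2' : (1 : ℝ) ≤ 1 := le_refl _
        linarith
      · rcases e4 with e1 | e1 <;> [left; right] <;> linarith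
  · simp only [cpt] at a1
    have hkl' : l = k ∨ l = k + f := by
      by_contra hcon
      exact h.2.2 k l (by omega) (by omega) a1
    rw [hh]; simp only [cpt]
    rcases hkl' with rfl | rfl
    · left
      rw [show ((l : ℝ) + t) - (l + s) = t - s by ring]
    · right
      push_cast
      have h1 := neg_abs_le (k + t - (k + f + s) : ℝ)
      have h2 := le_abs_self (t - s)
      linarith
  · exfalso
    simp only [cpt] at a1 a2
    have hl1 : l ≠ k := by
      rintro rfl
      exact (h.1 l).ne a1
    have hl2 : l ≠ k + f := by
      rintro rfl
      rw [add_right_comm, h.2.1] at a1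
      exact (h.1 k).ne a1
    have hl3 : l + 1 = k + f := by
      by_contra hcon
      exact h.2.2 k (l + 1) (by omega) (by omega) a1
    exact h.2.2 (k + 1) l (by omega) (by omega) a2

theorem triangleDelta_nonempty (hG : G.Connected) (T : MGTriangle G) :
    ((Fintype.card V : ℝ) + 1) ∈ {d : ℝ | 0 ≤ d ∧
    (∀ s ∈ Set.Icc T.a1 T.b1,
      (∃ t ∈ Set.Icc T.a2 T.b2, mgDist G (T.g1 s) (T.g2 t) ≤ d) ∨
      (∃ t ∈ Set.Icc T.a3 T.b3, mgDist G (T.g1 s) (T.g3 t) ≤ d)) ∧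
    (∀ s ∈ Set.Icc T.a2 T.b2,
      (∃ t ∈ Set.Icc T.a1 T.b1, mgDist G (T.g2 s) (T.g1 t) ≤ d) ∨
      (∃ t ∈ Set.Icc T.a3 T.b3, mgDist G (T.g2 s) (T.g3 t) ≤ d)) ∧
    (∀ s ∈ Set.Icc T.a3 T.b3,
      (∃ t ∈ Set.Icc T.a1 T.b1, mgDist G (T.g3 s) (T.g1 t) ≤ d) ∨
      (∃ t ∈ Set.Icc T.a2 T.b2, mgDist G (T.g3 s) (T.g2 t) ≤ d))} := by
  refine ⟨by positivity, fun s _ => ?_, fun s _ => ?_, fun s _ => ?_⟩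
  · exact Or.inl ⟨T.a2, ⟨le_refl _, T.h2.1⟩, mgDist_bdd hG _ _⟩
  · exact Or.inl ⟨T.a1, ⟨le_refl _, T.h1.1⟩, mgDist_bdd hG _ _⟩
  · exact Or.inl ⟨T.a1, ⟨le_refl _, T.h1.1⟩, mgDist_bdd hG _ _⟩

theorem hyp_ge (hG : G.Connected) (T : MGTriangle G) : triangleDelta T ≤ hypDelta G := by
  apply le_csSup
  · refine ⟨(Fintype.card V : ℝ) + 1, ?_⟩
    rintro _ ⟨T, rfl⟩
    exact csInf_le ⟨0, fun d hd => hd.1⟩ (triangleDelta_nonempty hG T)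
  · exact ⟨T, rfl⟩

/-- point at parameter `s` on a sequence -/
noncomputable def rpt {c : ℕ → V} (hc : ∀ k, G.Adj (c k) (c (k + 1))) (s : ℝ) : MGPoint G :=
  cpt hc ⌊s⌋₊ (Int.fract s) ⟨Int.fract_nonneg s, (Int.fract_lt_one s).le⟩

theorem rpt_dist_ge (hG : G.Connected) {f : ℕ} (hf : 3 ≤ f) {c : ℕ → V} (h : CycSeq G f c)
    (hgirth : G.girth = f) {s t : ℝ} (hs : 0 ≤ s) (hst : s ≤ t) (ht : t ≤ f) :
    t - s ≤ mgDist G (rpt h.1 s) (rpt h.1 t) ∨ f - (t - s) ≤ mgDist G (rpt h.1 s) (rpt h.1 t) := by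
  have hfl : ∀ x : ℝ, 0 ≤ x → (⌊x⌋₊ : ℝ) + Int.fract x = x := by
    intro x hx
    rw [natCast_floor_eq_intCast_floor hx, Int.floor_add_fract]
  have h1 := cpt_dist_ge hG hf h hgirth (Nat.floor_mono hst) (Nat.le_trans (Nat.floor_le_of_le ht)
    (Nat.le_add_left _ _)) (k := ⌊s⌋₊) (l := ⌊t⌋₊)
    ⟨Int.fract_nonneg s, (Int.fract_lt_one s).le⟩ ⟨Int.fract_nonneg t, (Int.fract_lt_one t).le⟩
  rw [hfl s hs, hfl t (hs.trans hst), abs_sub_comm, abs_of_nonneg (by linarith)] at h1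
  exact h1

theorem rpt_dist_le {c : ℕ → V} (hc : ∀ k, G.Adj (c k) (c (k + 1))) {s t : ℝ} (hs : 0 ≤ s)
    (ht : 0 ≤ t) : mgDist G (rpt hc s) (rpt hc t) ≤ |s - t| := by
  have hfl : ∀ x : ℝ, 0 ≤ x → (⌊x⌋₊ : ℝ) + Int.fract x = x := by
    intro x hx
    rw [natCast_floor_eq_intCast_floor hx, Int.floor_add_fract]
  have h1 := cpt_dist_le hc (k := ⌊s⌋₊) (l := ⌊t⌋₊)
    ⟨Int.fract_nonneg s, (Int.fract_lt_one s).le⟩ ⟨Int.fract_nonneg t, (Int.fract_lt_one t).le⟩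
  rw [hfl s hs, hfl t ht] at h1
  exact h1

theorem rpt_geo (hG : G.Connected) {f : ℕ} (hf : 3 ≤ f) {c : ℕ → V} (h : CycSeq G f c)
    (hgirth : G.girth = f) {a b : ℝ} (ha : 0 ≤ a) (hab : a ≤ b) (hb : b ≤ f) (hd : b - a ≤ f / 2) :
    IsMGGeodesic G a b (rpt h.1) := by
  refine ⟨hab, fun s hs t ht => ?_⟩
  wlog hst : s ≤ t generalizing s t
  · rw [mgDist_comm, abs_sub_comm]
    exact this t ht s hs (by linarith)
  apply le_antisymm
  · exact rpt_dist_le h.1 (ha.trans hs.1) (ha.trans ht.1)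
  · rw [abs_sub_comm, abs_of_nonneg (by linarith)]
    rcases rpt_dist_ge hG hf h hgirth (ha.trans hs.1) hst (ht.2.trans hb) with h' | h'
    · exact h'
    · have := hs.1
      have := ht.2
      linarith

theorem hyp_lower (hG : G.Connected) {g : ℕ} (hg : 3 ≤ g) (hgirth : G.girth = g) :
    (g : ℝ) / 4 ≤ hypDelta G := by
  have hac : ¬ G.IsAcyclic := by
    intro hh
    have := girth_eq_zero.2 hh
    omega
  obtain ⟨a, w, hw, hwl⟩ := exists_girth_eq_length.2 hac
  obtain ⟨c, hc⟩ := cycle_seq hw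
  rw [← hwl, hgirth] at hc
  have hg0 : (0 : ℝ) ≤ g := by positivity
  have h00 : ∀ p : MGPoint G, mgDist G p p = 0 := by
    intro p
    apply le_antisymm _ (mgDist_nonneg hG p p)
    simpa using mgDist_le_same p p rfl rfl
  have hend : rpt hc.1 (g : ℝ) = rpt hc.1 0 := by
    unfold rpt
    have := cpt_per hc 0 (Int.fract (0 : ℝ)) ⟨Int.fract_nonneg _, (Int.fract_lt_one _).le⟩
    simpa using this
  let T : MGTriangle G :=
    { a1 := 0, b1 := g / 2, a2 := g / 2, b2 := g, a3 := 0, b3 := 0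
      g1 := rpt hc.1, g2 := rpt hc.1, g3 := rpt hc.1
      h1 := rpt_geo hG hg hc hgirth le_rfl (by linarith) (by linarith) (by linarith)
      h2 := rpt_geo hG hg hc hgirth (by linarith) (by linarith) (by linarith) (by linarith)
      h3 := rpt_geo hG hg hc hgirth le_rfl le_rfl (by linarith) (by linarith)
      glue1 := h00 _
      glue2 := by rw [hend]; exact h00 _
      glue3 := h00 _ }
  refine le_trans ?_ (hyp_ge hG T)
  apply le_csInf ⟨_, triangleDelta_nonempty hG T⟩
  rintro d ⟨-, h1, -⟩
  rcases h1 (g / 4) ⟨by linarith, by show (g : ℝ) / 4 ≤ g / 2; linarith⟩ with ⟨t, ht, hd⟩ | ⟨t, ht, hd⟩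
  · have ht1 : (g : ℝ) / 2 ≤ t := ht.1
    have ht2 : t ≤ g := ht.2
    have hd' : mgDist G (rpt hc.1 (g / 4)) (rpt hc.1 t) ≤ d := hd
    rcases rpt_dist_ge hG hg hc hgirth (show (0 : ℝ) ≤ g / 4 by linarith)
      (show (g : ℝ) / 4 ≤ t by linarith) ht2 with h | h <;> linarith
  · have ht0 : t = 0 := le_antisymm ht.2 ht.1
    subst ht0
    have hd' : mgDist G (rpt hc.1 (g / 4)) (rpt hc.1 0) ≤ d := hd
    rw [mgDist_comm] at hd'
    rcases rpt_dist_ge hG hg hc hgirth le_rfl (show (0 : ℝ) ≤ g / 4 by linarith) (by linarith)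
      with h | h <;> linarith

end Seqs

open SimpleGraph Set
set_option linter.unusedSectionVars false

section Chain
variable {V : Type} [Fintype V] [DecidableEq V] {G : SimpleGraph V}

/-- A path-like decomposition of a graph into bags separated by single edges. -/
structure ChainData (G : SimpleGraph V) (D : ℝ) where
  M : ℕ
  F : ℕ → V → ℤ
  t : ℕ → V
  b : ℕ → V
  adj : ∀ k u v, G.Adj u v → |F k u - F k v| ≤ 1
  mono : ∀ k v, F (k + 1) v ≤ F k v
  zero : ∀ v, 0 ≤ F 0 v
  last : ∀ v, F (M + 1) v ≤ 0
  rung : ∀ k, 1 ≤ k → k ≤ M → G.Adj (t k) (b k)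
  Ft : ∀ k, 1 ≤ k → k ≤ M → F k (t k) = 0
  Fb : ∀ k, 1 ≤ k → k ≤ M → F k (b k) = 0
  Fz : ∀ k, 1 ≤ k → k ≤ M → ∀ v, F k v = 0 → v = t k ∨ v = b k
  diam : ∀ k, k ≤ M → ∀ p q : MGPoint G,
    0 ≤ F k p.1.1 → 0 ≤ F k p.1.2.1 → F (k + 1) p.1.1 ≤ 0 → F (k + 1) p.1.2.1 ≤ 0 →
    0 ≤ F k q.1.1 → 0 ≤ F k q.1.2.1 → F (k + 1) q.1.1 ≤ 0 → F (k + 1) q.1.2.1 ≤ 0 →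
    mgDist G p q ≤ 2 * D - 1
  mid : ∀ k, 1 ≤ k → k + 1 ≤ M → ∀ p q q' : MGPoint G,
    0 ≤ F k p.1.1 → 0 ≤ F k p.1.2.1 → F (k + 1) p.1.1 ≤ 0 → F (k + 1) p.1.2.1 ≤ 0 →
    q.1.1 = t k → q.1.2.1 = b k → q'.1.1 = t (k + 1) → q'.1.2.1 = b (k + 1) →
    mgDist G p q ≤ D ∨ mgDist G p q' ≤ D

variable {D : ℝ} (C : ChainData G D)

/-- membership in a bag -/
def ChainData.inBag (k : ℕ) (p : MGPoint G) : Prop :=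
  0 ≤ C.F k p.1.1 ∧ 0 ≤ C.F k p.1.2.1 ∧ C.F (k + 1) p.1.1 ≤ 0 ∧ C.F (k + 1) p.1.2.1 ≤ 0

/-- extended separating function -/
noncomputable def ChainData.ext (k : ℕ) (p : MGPoint G) : ℝ := mgExt (fun v => (C.F k v : ℝ)) p

theorem ChainData.lip (k : ℕ) : ∀ u v, G.Adj u v → |(C.F k u : ℝ) - C.F k v| ≤ 1 := by
  intro u v h
  exact_mod_cast C.adj k u v h

theorem ChainData.anti {k l : ℕ} (h : k ≤ l) (v : V) : C.F l v ≤ C.F k v := by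
  induction h with
  | refl => exact le_rfl
  | step _ ih => exact (C.mono _ v).trans ih

theorem ChainData.ext_nonneg {k : ℕ} {p : MGPoint G} (h1 : 0 ≤ C.F k p.1.1)
    (h2 : 0 ≤ C.F k p.1.2.1) : 0 ≤ C.ext k p := by
  have h1' : (0 : ℝ) ≤ C.F k p.1.1 := by exact_mod_cast h1
  have h2' : (0 : ℝ) ≤ C.F k p.1.2.1 := by exact_mod_cast h2
  have hp0 := p.2.2.1
  have hp1 := p.2.2.2
  unfold ChainData.ext mgExt
  nlinarith

theorem ChainData.ext_nonpos {k : ℕ} {p : MGPoint G} (h1 : C.F k p.1.1 ≤ 0)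
    (h2 : C.F k p.1.2.1 ≤ 0) : C.ext k p ≤ 0 := by
  have h1' : (C.F k p.1.1 : ℝ) ≤ 0 := by exact_mod_cast h1
  have h2' : (C.F k p.1.2.1 : ℝ) ≤ 0 := by exact_mod_cast h2
  have hp0 := p.2.2.1
  have hp1 := p.2.2.2
  unfold ChainData.ext mgExt
  nlinarith

theorem ChainData.exists_bag (p : MGPoint G) : ∃ j ≤ C.M, C.inBag j p := by
  classical
  set P : ℕ → Prop := fun k => 0 ≤ C.F k p.1.1 ∧ 0 ≤ C.F k p.1.2.1 with hP
  have h0 : P 0 := ⟨C.zero _, C.zero _⟩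
  have hs : P (Nat.findGreatest P C.M) := Nat.findGreatest_spec (Nat.zero_le _) h0
  have hle : Nat.findGreatest P C.M ≤ C.M := Nat.findGreatest_le _
  refine ⟨_, hle, hs.1, hs.2, ?_⟩
  rcases hle.lt_or_eq with hlt | heq
  · have hn : ¬ (0 ≤ C.F (Nat.findGreatest P C.M + 1) p.1.1 ∧
        0 ≤ C.F (Nat.findGreatest P C.M + 1) p.1.2.1) :=
      Nat.findGreatest_is_greatest (Nat.lt_succ_self _) hlt
    have := abs_le.1 (C.adj (Nat.findGreatest P C.M + 1) _ _ p.2.1)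
    constructor <;> by_contra hcon <;> apply hn <;> constructor <;> omega
  · rw [heq]; exact ⟨C.last _, C.last _⟩

/-- a point on a rung -/
def ChainData.rpt (k : ℕ) (h1 : 1 ≤ k) (h2 : k ≤ C.M) (h : ℝ) (hh : h ∈ Icc (0 : ℝ) 1) : MGPoint G :=
  ⟨(C.t k, C.b k, h), C.rung k h1 h2, hh⟩

theorem ChainData.rpt_dist {k : ℕ} (h1 : 1 ≤ k) (h2 : k ≤ C.M) {h h' : ℝ} (hh : h ∈ Icc (0 : ℝ) 1)
    (hh' : h' ∈ Icc (0 : ℝ) 1) :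
    mgDist G (C.rpt k h1 h2 h hh) (C.rpt k h1 h2 h' hh') ≤ |h - h'| :=
  mgDist_le_same _ _ rfl rfl

theorem mg_zero_of_le (hG : G.Connected) {p q : MGPoint G} (h : mgDist G p q ≤ 0) :
    mgDist G p q = 0 := le_antisymm h (mgDist_nonneg hG p q)

theorem ChainData.exists_rpt (hG : G.Connected) {k : ℕ} (h1 : 1 ≤ k) (h2 : k ≤ C.M)
    {p : MGPoint G} (hp : C.ext k p = 0) :
    ∃ h hh, mgDist G p (C.rpt k h1 h2 h hh) = 0 := by
  have hp0 := p.2.2.1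
  have hp1 := p.2.2.2
  have ha := abs_le.1 (C.adj k _ _ p.2.1)
  have hne := p.2.1.ne
  have hp : (1 - p.1.2.2) * (C.F k p.1.1 : ℝ) + p.1.2.2 * (C.F k p.1.2.1 : ℝ) = 0 := hp
  by_cases hu : C.F k p.1.1 = 0
  · by_cases hv : C.F k p.1.2.1 = 0
    · have hu' := C.Fz k h1 h2 _ hu
      have hv' := C.Fz k h1 h2 _ hv
      rcases hu' with hu' | hu' <;> rcases hv' with hv' | hv'
      · exact absurd (hu'.trans hv'.symm) hne
      · refine ⟨p.1.2.2, ⟨hp0, hp1⟩, mg_zero_of_le hG ?_⟩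
        have := mgDist_le_same p (C.rpt k h1 h2 p.1.2.2 ⟨hp0, hp1⟩) hu' hv'
        simpa [ChainData.rpt] using this
      · refine ⟨1 - p.1.2.2, ⟨by linarith, by linarith⟩, mg_zero_of_le hG ?_⟩
        have := mgDist_le_flip p (C.rpt k h1 h2 (1 - p.1.2.2) ⟨by linarith, by linarith⟩) hu' hv'
        simpa [ChainData.rpt] using this
      · exact absurd (hu'.trans hv'.symm) hne
    · have ht : p.1.2.2 = 0 := by
        have hv' : (C.F k p.1.2.1 : ℝ) ≠ 0 := by exact_mod_cast hv
        rw [hu] at hp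
        simp only [Int.cast_zero, mul_zero, zero_add] at hp
        exact (mul_eq_zero.1 hp).resolve_right hv'
      rcases C.Fz k h1 h2 _ hu with hu' | hu'
      · refine ⟨0, ⟨le_rfl, zero_le_one⟩, mg_zero_of_le hG ?_⟩
        have a1 := mgDist_le_u p (C.rpt k h1 h2 0 ⟨le_rfl, zero_le_one⟩)
        have a2 := mgVDist_le_u p.1.1 (C.rpt k h1 h2 0 ⟨le_rfl, zero_le_one⟩)
        simp only [ChainData.rpt, hu', SimpleGraph.dist_self] at a1 a2 ⊢
        push_cast at a2
        linarith
      · refine ⟨1, ⟨zero_le_one, le_rfl⟩, mg_zero_of_le hG ?_⟩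
        have a1 := mgDist_le_u p (C.rpt k h1 h2 1 ⟨zero_le_one, le_rfl⟩)
        have a2 := mgVDist_le_v p.1.1 (C.rpt k h1 h2 1 ⟨zero_le_one, le_rfl⟩)
        simp only [ChainData.rpt, hu', SimpleGraph.dist_self] at a1 a2 ⊢
        push_cast at a2
        linarith
  · by_cases hv : C.F k p.1.2.1 = 0
    · have ht : p.1.2.2 = 1 := by
        have hu' : (C.F k p.1.1 : ℝ) ≠ 0 := by exact_mod_cast hu
        rw [hv] at hp
        simp only [Int.cast_zero, mul_zero, add_zero] at hp
        have := (mul_eq_zero.1 hp).resolve_right hu'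
        linarith
      rcases C.Fz k h1 h2 _ hv with hu' | hu'
      · refine ⟨0, ⟨le_rfl, zero_le_one⟩, mg_zero_of_le hG ?_⟩
        have a1 := mgDist_le_v p (C.rpt k h1 h2 0 ⟨le_rfl, zero_le_one⟩)
        have a2 := mgVDist_le_u p.1.2.1 (C.rpt k h1 h2 0 ⟨le_rfl, zero_le_one⟩)
        simp only [ChainData.rpt, hu', SimpleGraph.dist_self] at a1 a2 ⊢
        push_cast at a2
        linarith
      · refine ⟨1, ⟨zero_le_one, le_rfl⟩, mg_zero_of_le hG ?_⟩
        have a1 := mgDist_le_v p (C.rpt k h1 h2 1 ⟨zero_le_one, le_rfl⟩)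
        have a2 := mgVDist_le_v p.1.2.1 (C.rpt k h1 h2 1 ⟨zero_le_one, le_rfl⟩)
        simp only [ChainData.rpt, hu', SimpleGraph.dist_self] at a1 a2 ⊢
        push_cast at a2
        linarith
    · exfalso
      rcases lt_or_gt_of_ne hu with hu' | hu'
      · have hv' : C.F k p.1.2.1 ≤ -1 := by omega
        have hu'' : C.F k p.1.1 ≤ -1 := by omega
        have x1 : (C.F k p.1.2.1 : ℝ) ≤ -1 := by exact_mod_cast hv'
        have x2 : (C.F k p.1.1 : ℝ) ≤ -1 := by exact_mod_cast hu''
        nlinarith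
      · have hv' : 1 ≤ C.F k p.1.2.1 := by omega
        have hu'' : 1 ≤ C.F k p.1.1 := by omega
        have x1 : (1 : ℝ) ≤ C.F k p.1.2.1 := by exact_mod_cast hv'
        have x2 : (1 : ℝ) ≤ C.F k p.1.1 := by exact_mod_cast hu''
        nlinarith

theorem ChainData.ext_congr (hG : G.Connected) {k : ℕ} {p q : MGPoint G} (h : mgDist G p q = 0) :
    C.ext k p = C.ext k q := by
  have := lip_mg hG (C.lip k) p q
  rw [h] at this
  have := abs_nonpos_iff.1 this
  unfold ChainData.ext
  linarith

theorem ChainData.conv (hG : G.Connected) {k : ℕ} (h1 : 1 ≤ k) (h2 : k ≤ C.M) {h h' : ℝ}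
    (hh : h ∈ Icc (0 : ℝ) 1) (hh' : h' ∈ Icc (0 : ℝ) 1) {p : MGPoint G}
    (hd : mgDist G (C.rpt k h1 h2 h hh) p + mgDist G (C.rpt k h1 h2 h' hh') p ≤ |h - h'|) :
    C.ext k p = 0 := by
  have hFt := C.Ft k h1 h2
  have hFb := C.Fb k h1 h2
  have n1 := mgVDist_nonneg (C.t k) p
  have n2 := mgVDist_nonneg (C.b k) p
  have hzt : mgVDist G (C.t k) p ≤ 0 → C.ext k p = 0 := by
    intro hz
    have := lip_v hG (C.lip k) (C.t k) p
    have := abs_nonpos_iff.1 (this.trans hz)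
    rw [hFt] at this
    push_cast at this
    unfold ChainData.ext
    linarith
  have hzb : mgVDist G (C.b k) p ≤ 0 → C.ext k p = 0 := by
    intro hz
    have := lip_v hG (C.lip k) (C.b k) p
    have := abs_nonpos_iff.1 (this.trans hz)
    rw [hFb] at this
    push_cast at this
    unfold ChainData.ext
    linarith
  have hsame : (p.1.1 = C.t k ∧ p.1.2.1 = C.b k) ∨ (p.1.1 = C.b k ∧ p.1.2.1 = C.t k) →
      C.ext k p = 0 := by
    show _ → (1 - p.1.2.2) * (C.F k p.1.1 : ℝ) + p.1.2.2 * (C.F k p.1.2.1 : ℝ) = 0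
    rintro (⟨e1, e2⟩ | ⟨e1, e2⟩) <;> rw [e1, e2, hFt, hFb] <;> simp
  have hcases : ∀ h hh, C.ext k p = 0 ∨ mgDist G (C.rpt k h1 h2 h hh) p = h + mgVDist G (C.t k) p ∨
      mgDist G (C.rpt k h1 h2 h hh) p = (1 - h) + mgVDist G (C.b k) p := by
    intro h hh
    rcases mgDist_cases hG (C.rpt k h1 h2 h hh) p with e | e | ⟨e1, e2, e⟩ | ⟨e1, e2, e⟩
    · exact Or.inr (Or.inl e)
    · exact Or.inr (Or.inr e)
    · exact Or.inl (hsame (Or.inl ⟨e1.symm, e2.symm⟩))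
    · exact Or.inl (hsame (Or.inr ⟨e2.symm, e1.symm⟩))
  have hTB : mgVDist G (C.t k) p + mgVDist G (C.b k) p ≤ 1 → C.ext k p = 0 := by
    intro hle
    have hp0 := p.2.2.1
    have hp1 := p.2.2.2
    have key : ∀ (x : V) (τ : ℝ), 0 ≤ τ → mgVDist G (C.t k) p = G.dist (C.t k) x + τ →
        mgVDist G (C.b k) p = G.dist (C.b k) x + τ → C.ext k p = 0 := by
      intro x τ hτ e e'
      have t1 := hG.dist_triangle (u := C.t k) (v := x) (w := C.b k)
      rw [SimpleGraph.dist_comm (u := x)] at t1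
      rw [SimpleGraph.dist_eq_one_iff_adj.2 (C.rung k h1 h2)] at t1
      have t1' : (1 : ℝ) ≤ G.dist (C.t k) x + G.dist (C.b k) x := by exact_mod_cast t1
      have hτ0 : τ = 0 := by linarith
      have t2 : ((G.dist (C.t k) x + G.dist (C.b k) x : ℕ) : ℝ) ≤ (1 : ℕ) := by
        push_cast; linarith
      have t2 := Nat.cast_le.1 t2
      have t3 : G.dist (C.t k) x = 0 ∨ G.dist (C.b k) x = 0 := by omega
      rcases t3 with t3 | t3
      · apply hzt; rw [e, t3, hτ0]; simp
      · apply hzb; rw [e', t3, hτ0]; simp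
    have key2 : ∀ (x y : V) (τ : ℝ), mgVDist G (C.t k) p = G.dist (C.t k) x + τ →
        mgVDist G (C.b k) p = G.dist (C.b k) y + (1 - τ) → C.t k = x ∧ C.b k = y := by
      intro x y τ e e'
      have t2 : ((G.dist (C.t k) x + G.dist (C.b k) y : ℕ) : ℝ) ≤ (0 : ℕ) := by
        push_cast; linarith
      have t2 := Nat.cast_le.1 t2
      constructor
      · exact hG.dist_eq_zero_iff.1 (by omega)
      · exact hG.dist_eq_zero_iff.1 (by omega)
    rcases mgVDist_cases (C.t k) p with e | e <;> rcases mgVDist_cases (C.b k) p with e' | e'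
    · exact key _ _ hp0 e e'
    · obtain ⟨x1, x2⟩ := key2 _ _ _ e e'
      exact hsame (Or.inl ⟨x1.symm, x2.symm⟩)
    · obtain ⟨x1, x2⟩ := key2 _ _ (1 - p.1.2.2) e (by linarith)
      exact hsame (Or.inr ⟨x2.symm, x1.symm⟩)
    · exact key _ _ (by linarith) e e'
  obtain ⟨hh0, hh1⟩ := hh
  obtain ⟨hh0', hh1'⟩ := hh'
  rcases hcases h ⟨hh0, hh1⟩ with e | e | e
  · exact e
  all_goals
    rcases hcases h' ⟨hh0', hh1'⟩ with e' | e' | e'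
    · exact e'
    all_goals rw [e, e'] at hd
  all_goals rcases abs_cases (h - h') with ⟨ha, -⟩ | ⟨ha, -⟩ <;> rw [ha] at hd
  all_goals first
    | exact hzt (by linarith)
    | exact hzb (by linarith)
    | exact hTB (by linarith)

/-- a set of points that connects `x` to `y` -/
def Connects (S : Set (MGPoint G)) (x y : MGPoint G) : Prop :=
  (∃ q ∈ S, mgDist G x q = 0) ∧ (∃ q ∈ S, mgDist G y q = 0) ∧
  ∀ F : V → ℝ, (∀ u v, G.Adj u v → |F u - F v| ≤ 1) →
    (mgExt F x ≤ 0 ∧ 0 ≤ mgExt F y ∨ mgExt F y ≤ 0 ∧ 0 ≤ mgExt F x) → ∃ q ∈ S, mgExt F q = 0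

theorem Connects.symm {S : Set (MGPoint G)} {x y : MGPoint G} (h : Connects S x y) :
    Connects S y x := ⟨h.2.1, h.1, fun F hF hh => h.2.2 F hF hh.symm⟩

theorem mg_le_of_zero (hG : G.Connected) {p q r : MGPoint G} (h : mgDist G q r = 0) :
    mgDist G p r ≤ mgDist G p q := by
  have := mgDist_tri hG p q r
  linarith

theorem geo_reverse {a b : ℝ} {γ : ℝ → MGPoint G} (hγ : IsMGGeodesic G a b γ) :
    IsMGGeodesic G (-b) (-a) (fun r => γ (-r)) := by
  refine ⟨by linarith [hγ.1], fun s hs t ht => ?_⟩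
  have := hγ.2 (-s) ⟨by linarith [hs.2], by linarith [hs.1]⟩ (-t) ⟨by linarith [ht.2], by linarith [ht.1]⟩
  rw [this, abs_sub_comm]
  congr 1
  ring

theorem geo_dist {a b : ℝ} {γ : ℝ → MGPoint G} (hγ : IsMGGeodesic G a b γ) {s t : ℝ}
    (hs : a ≤ s) (hst : s ≤ t) (ht : t ≤ b) : mgDist G (γ s) (γ t) = t - s := by
  rw [hγ.2 s ⟨hs, hst.trans ht⟩ t ⟨hs.trans hst, ht⟩, abs_sub_comm, abs_of_nonneg (by linarith)]

theorem ChainData.geo_conv (hG : G.Connected) {k : ℕ} (h1 : 1 ≤ k) (h2 : k ≤ C.M) {a b s : ℝ}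
    {γ : ℝ → MGPoint G} (hγ : IsMGGeodesic G a b γ) (hs : s ∈ Icc a b)
    (hsign : (C.ext k (γ s) ≤ 0 ∧ 0 ≤ C.ext k (γ a) ∧ 0 ≤ C.ext k (γ b)) ∨
      (0 ≤ C.ext k (γ s) ∧ C.ext k (γ a) ≤ 0 ∧ C.ext k (γ b) ≤ 0)) : C.ext k (γ s) = 0 := by
  have ha : a ∈ Icc a b := ⟨le_rfl, hγ.1⟩
  have hb : b ∈ Icc a b := ⟨hγ.1, le_rfl⟩
  have hr1 : ∃ r, a ≤ r ∧ r ≤ s ∧ C.ext k (γ r) = 0 := by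
    rcases hsign with ⟨e1, e2, e3⟩ | ⟨e1, e2, e3⟩
    · obtain ⟨r, hr, hr', hr0⟩ := geo_ivt hG (C.lip k) hγ hs ha e1 e2
      rw [uIcc_of_ge hs.1] at hr
      exact ⟨r, hr.1, hr.2, hr0⟩
    · obtain ⟨r, hr, hr', hr0⟩ := geo_ivt hG (C.lip k) hγ ha hs e2 e1
      rw [uIcc_of_le hs.1] at hr
      exact ⟨r, hr.1, hr.2, hr0⟩
  have hr2 : ∃ r, s ≤ r ∧ r ≤ b ∧ C.ext k (γ r) = 0 := by
    rcases hsign with ⟨e1, e2, e3⟩ | ⟨e1, e2, e3⟩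
    · obtain ⟨r, hr, hr', hr0⟩ := geo_ivt hG (C.lip k) hγ hs hb e1 e3
      rw [uIcc_of_le hs.2] at hr
      exact ⟨r, hr.1, hr.2, hr0⟩
    · obtain ⟨r, hr, hr', hr0⟩ := geo_ivt hG (C.lip k) hγ hb hs e3 e1
      rw [uIcc_of_ge hs.2] at hr
      exact ⟨r, hr.1, hr.2, hr0⟩
  obtain ⟨r1, a1, b1, c1⟩ := hr1
  obtain ⟨r2, a2, b2, c2⟩ := hr2
  obtain ⟨h, hh, e1⟩ := C.exists_rpt hG h1 h2 c1
  obtain ⟨h', hh', e2⟩ := C.exists_rpt hG h1 h2 c2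
  apply C.conv hG h1 h2 hh hh'
  have d1 := geo_dist hγ a1 b1 hs.2
  have d2 := geo_dist hγ hs.1 a2 b2
  have d3 := geo_dist hγ a1 (b1.trans a2) b2
  have i1 := mgDist_tri hG (C.rpt k h1 h2 h hh) (γ r1) (γ s)
  rw [mgDist_comm _ (γ r1)] at i1
  have i2 := mgDist_tri hG (γ s) (γ r2) (C.rpt k h1 h2 h' hh')
  rw [mgDist_comm (γ s) (C.rpt k h1 h2 h' hh')] at i2
  have i3 := mgDist_tri hG (γ r1) (C.rpt k h1 h2 h hh) (γ r2)
  have i4 := mgDist_tri hG (C.rpt k h1 h2 h hh) (C.rpt k h1 h2 h' hh') (γ r2)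
  rw [mgDist_comm (C.rpt k h1 h2 h' hh') (γ r2)] at i4
  have i5 := C.rpt_dist h1 h2 hh hh'
  linarith

theorem abs_sub_unit {h h' : ℝ} (hh : h ∈ Icc (0 : ℝ) 1) (hh' : h' ∈ Icc (0 : ℝ) 1) : |h - h'| ≤ 1 := by
  rw [abs_le]; constructor <;> linarith [hh.1, hh.2, hh'.1, hh'.2]

theorem ChainData.core (C : ChainData G D) (hG : G.Connected) {a b s : ℝ} {γ : ℝ → MGPoint G}
    (hγ : IsMGGeodesic G a b γ) (hs : s ∈ Icc a b) {S : Set (MGPoint G)}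
    (hS : Connects S (γ a) (γ b)) : ∃ q ∈ S, mgDist G (γ s) q ≤ D := by
  obtain ⟨jx, hjx, bx⟩ := C.exists_bag (γ a)
  obtain ⟨jy, hjy, bY⟩ := C.exists_bag (γ b)
  wlog hle : jx ≤ jy generalizing a b s γ jx jy
  · have := this (geo_reverse hγ) (s := -s) ⟨by linarith [hs.2], by linarith [hs.1]⟩
      (by simpa using hS.symm) jy hjy (by simpa using bY) jx hjx (by simpa using bx) (by omega)
    simpa using this
  have ha : a ∈ Icc a b := ⟨le_rfl, hγ.1⟩
  have hb : b ∈ Icc a b := ⟨hγ.1, le_rfl⟩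
  have hp : ∃ i p', jx ≤ i ∧ i ≤ jy ∧ C.inBag i p' ∧ mgDist G (γ s) p' = 0 := by
    obtain ⟨jp, hjp, bp⟩ := C.exists_bag (γ s)
    rcases lt_or_ge jp jx with hlt | hge
    · have k1 : 1 ≤ jx := by omega
      have h0 : C.ext jx (γ s) = 0 := by
        apply C.geo_conv hG k1 hjx hγ hs
        left
        refine ⟨C.ext_nonpos ((C.anti hlt _).trans bp.2.2.1) ((C.anti hlt _).trans bp.2.2.2),
          C.ext_nonneg bx.1 bx.2.1,
          C.ext_nonneg (bY.1.trans (C.anti hle _)) (bY.2.1.trans (C.anti hle _))⟩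
      obtain ⟨h, hh, e⟩ := C.exists_rpt hG k1 hjx h0
      refine ⟨jx, _, le_rfl, hle, ?_, e⟩
      have z1 := C.Ft jx k1 hjx
      have z2 := C.Fb jx k1 hjx
      exact ⟨z1.ge, z2.ge, (C.mono _ _).trans z1.le, (C.mono _ _).trans z2.le⟩
    · rcases lt_or_ge jy jp with hlt | hge'
      · have k1 : 1 ≤ jy + 1 := by omega
        have k2 : jy + 1 ≤ C.M := by omega
        have h0 : C.ext (jy + 1) (γ s) = 0 := by
          apply C.geo_conv hG k1 k2 hγ hs
          right
          refine ⟨C.ext_nonneg (bp.1.trans (C.anti hlt _)) (bp.2.1.trans (C.anti hlt _)),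
            C.ext_nonpos ((C.anti (by omega) _).trans bx.2.2.1) ((C.anti (by omega) _).trans bx.2.2.2),
            C.ext_nonpos bY.2.2.1 bY.2.2.2⟩
        obtain ⟨h, hh, e⟩ := C.exists_rpt hG k1 k2 h0
        refine ⟨jy, _, hle, le_rfl, ?_, e⟩
        have z1 := C.Ft (jy + 1) k1 k2
        have z2 := C.Fb (jy + 1) k1 k2
        exact ⟨z1.ge.trans (C.mono _ _), z2.ge.trans (C.mono _ _), z1.le, z2.le⟩
      · exact ⟨jp, γ s, hge, hge', bp, mg_zero_of_le hG (by simpa using mgDist_le_same (γ s) (γ s) rfl rfl)⟩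
  obtain ⟨i, p', hi1, hi2, bi, hp'⟩ := hp
  obtain ⟨⟨qx, hqx, ex⟩, ⟨qy, hqy, ey⟩, hivt⟩ := hS
  have dx : mgDist G (γ s) qx ≤ s - a := by
    have := mg_le_of_zero hG (p := γ s) ex
    rw [mgDist_comm (γ s) (γ a), geo_dist hγ le_rfl hs.1 hs.2] at this
    exact this
  have dy : mgDist G (γ s) qy ≤ b - s := by
    have := mg_le_of_zero hG (p := γ s) ey
    rw [geo_dist hγ hs.1 hs.2 le_rfl] at this
    exact this
  -- crossing points of the connecting set with the rungs in between
  have cross : ∀ k (k1 : 1 ≤ k) (k2 : k ≤ C.M), jx < k → k ≤ jy →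
      ∃ q ∈ S, ∃ h hh, mgDist G q (C.rpt k k1 k2 h hh) = 0 := by
    intro k k1 k2 hk1 hk2
    obtain ⟨q, hq, hq0⟩ := hivt _ (C.lip k) (Or.inl
      ⟨C.ext_nonpos ((C.anti hk1 _).trans bx.2.2.1) ((C.anti hk1 _).trans bx.2.2.2),
      C.ext_nonneg (bY.1.trans (C.anti hk2 _)) (bY.2.1.trans (C.anti hk2 _))⟩)
    obtain ⟨h, hh, e⟩ := C.exists_rpt hG k1 k2 hq0
    exact ⟨q, hq, h, hh, e⟩
  have rb1 : ∀ k (k1 : 1 ≤ k) (k2 : k ≤ C.M) h hh, C.inBag k (C.rpt k k1 k2 h hh) := by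
    intro k k1 k2 h hh
    have z1 := C.Ft k k1 k2
    have z2 := C.Fb k k1 k2
    exact ⟨z1.ge, z2.ge, (C.mono _ _).trans z1.le, (C.mono _ _).trans z2.le⟩
  have rb2 : ∀ k (k1 : 1 ≤ k + 1) (k2 : k + 1 ≤ C.M) h hh, C.inBag k (C.rpt (k + 1) k1 k2 h hh) := by
    intro k k1 k2 h hh
    have z1 := C.Ft (k + 1) k1 k2
    have z2 := C.Fb (k + 1) k1 k2
    exact ⟨z1.ge.trans (C.mono _ _), z2.ge.trans (C.mono _ _), z1.le, z2.le⟩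
  have hdiam : ∀ k, k ≤ C.M → ∀ p q, C.inBag k p → C.inBag k q → mgDist G p q ≤ 2 * D - 1 := by
    intro k hk p q hp hq
    exact C.diam k hk p q hp.1 hp.2.1 hp.2.2.1 hp.2.2.2 hq.1 hq.2.1 hq.2.2.1 hq.2.2.2
  rcases hi1.lt_or_eq with hi1 | rfl
  · have i1 : 1 ≤ i := by omega
    have i2 : i ≤ C.M := by omega
    obtain ⟨q, hq, h, hh, e⟩ := cross i i1 i2 hi1 hi2
    rcases hi2.lt_or_eq with hi2 | rfl
    · -- strictly between
      obtain ⟨q', hq', h', hh', e'⟩ := cross (i + 1) (by omega) (by omega) (by omega) hi2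
      have d1 : ∀ r r', mgDist G r r' = 0 → mgDist G (γ s) r ≤ mgDist G p' r' := by
        intro r r' hr
        have := mgDist_tri hG (γ s) p' r
        have := mgDist_tri hG p' r' r
        rw [mgDist_comm r' r] at this
        linarith
      rcases C.mid i i1 (by omega) p' (C.rpt i i1 i2 h hh) (C.rpt (i + 1) (by omega) (by omega) h' hh')
        bi.1 bi.2.1 bi.2.2.1 bi.2.2.2 rfl rfl rfl rfl with hm | hm
      · exact ⟨q, hq, (d1 _ _ e).trans hm⟩
      · exact ⟨q', hq', (d1 _ _ e').trans hm⟩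
    · -- y in the bag, x to the left
      obtain ⟨r, hr, hr', hr0⟩ := geo_ivt hG (C.lip i) hγ ha hs
        (C.ext_nonpos ((C.anti hi1 _).trans bx.2.2.1) ((C.anti hi1 _).trans bx.2.2.2))
        (by
          have := C.ext_congr hG (k := i) hp'
          unfold ChainData.ext at this
          rw [this]
          exact C.ext_nonneg bi.1 bi.2.1)
      rw [uIcc_of_le hs.1] at hr
      obtain ⟨h', hh', e'⟩ := C.exists_rpt hG i1 i2 hr0
      have d1 := hdiam i i2 _ _ (rb1 i i1 i2 h' hh') bY
      have d2 := mgDist_tri hG (γ r) (C.rpt i i1 i2 h' hh') (γ b)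
      rw [geo_dist hγ hr.1 (hr.2.trans hs.2) le_rfl] at d2
      have d3 := C.rpt_dist i1 i2 hh' hh
      have d4 := abs_sub_unit hh' hh
      have d5 := mgDist_tri hG (γ s) (γ r) q
      have d6 := mgDist_tri hG (γ r) (C.rpt i i1 i2 h' hh') q
      have d7 := mgDist_tri hG (C.rpt i i1 i2 h' hh') (C.rpt i i1 i2 h hh) q
      rw [mgDist_comm (C.rpt i i1 i2 h hh) q] at d7
      rw [mgDist_comm (γ s) (γ r), geo_dist hγ hr.1 hr.2 hs.2] at d5
      by_cases hD : b - s ≤ D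
      · exact ⟨qy, hqy, dy.trans hD⟩
      · exact ⟨q, hq, by linarith⟩
  · rcases hi2.lt_or_eq with hi2 | rfl
    · -- x in the bag, y to the right
      have i1 : 1 ≤ jx + 1 := by omega
      have i2 : jx + 1 ≤ C.M := by omega
      obtain ⟨q, hq, h, hh, e⟩ := cross (jx + 1) i1 i2 (by omega) hi2
      obtain ⟨r, hr, hr', hr0⟩ := geo_ivt hG (C.lip (jx + 1)) hγ hs hb
        (by
          have := C.ext_congr hG (k := jx + 1) hp'
          unfold ChainData.ext at this
          rw [this]
          exact C.ext_nonpos bi.2.2.1 bi.2.2.2)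
        (C.ext_nonneg (bY.1.trans (C.anti hi2 _)) (bY.2.1.trans (C.anti hi2 _)))
      rw [uIcc_of_le hs.2] at hr
      obtain ⟨h', hh', e'⟩ := C.exists_rpt hG i1 i2 hr0
      have d1 := hdiam jx hjx _ _ (rb2 jx i1 i2 h' hh') bx
      have d2 := mgDist_tri hG (γ a) (C.rpt (jx + 1) i1 i2 h' hh') (γ r)
      rw [geo_dist hγ le_rfl (hs.1.trans hr.1) hr.2, mgDist_comm (γ a), mgDist_comm _ (γ r)] at d2
      have d3 := C.rpt_dist i1 i2 hh' hh
      have d4 := abs_sub_unit hh' hh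
      have d5 := mgDist_tri hG (γ s) (γ r) q
      have d6 := mgDist_tri hG (γ r) (C.rpt (jx + 1) i1 i2 h' hh') q
      have d7 := mgDist_tri hG (C.rpt (jx + 1) i1 i2 h' hh') (C.rpt (jx + 1) i1 i2 h hh) q
      rw [mgDist_comm (C.rpt (jx + 1) i1 i2 h hh) q] at d7
      rw [geo_dist hγ hs.1 hr.1 hr.2] at d5
      by_cases hD : s - a ≤ D
      · exact ⟨qx, hqx, dx.trans hD⟩
      · exact ⟨q, hq, by linarith⟩
    · have d1 := hdiam jx hjx _ _ bx bY
      rw [geo_dist hγ le_rfl hγ.1 le_rfl] at d1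
      by_cases hD : s - a ≤ D
      · exact ⟨qx, hqx, dx.trans hD⟩
      · exact ⟨qy, hqy, by linarith⟩

/-- two consecutive geodesics connect -/
theorem connects_two (hG : G.Connected) {a b a' b' : ℝ} {γ γ' : ℝ → MGPoint G}
    (hγ : IsMGGeodesic G a b γ) (hγ' : IsMGGeodesic G a' b' γ')
    (hglue : mgDist G (γ b) (γ' a') = 0) {x y : MGPoint G} (hx : mgDist G x (γ a) = 0)
    (hy : mgDist G y (γ' b') = 0) :
    Connects ((γ '' Icc a b) ∪ (γ' '' Icc a' b')) x y := by
  have ha : a ∈ Icc a b := ⟨le_rfl, hγ.1⟩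
  have hb : b ∈ Icc a b := ⟨hγ.1, le_rfl⟩
  have ha' : a' ∈ Icc a' b' := ⟨le_rfl, hγ'.1⟩
  have hb' : b' ∈ Icc a' b' := ⟨hγ'.1, le_rfl⟩
  refine ⟨⟨γ a, Or.inl ⟨a, ha, rfl⟩, hx⟩, ⟨γ' b', Or.inr ⟨b', hb', rfl⟩, hy⟩, ?_⟩
  intro F hF hsign
  have hz : ∀ {p q : MGPoint G}, mgDist G p q = 0 → mgExt F p = mgExt F q := by
    intro p q h
    have := lip_mg hG hF p q
    rw [h] at this
    have := abs_nonpos_iff.1 this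
    linarith
  rw [hz hx, hz hy] at hsign
  have hz3 := hz hglue
  rcases hsign with ⟨e1, e2⟩ | ⟨e1, e2⟩
  · rcases le_total 0 (mgExt F (γ b)) with h | h
    · obtain ⟨r, -, hr, hr0⟩ := geo_ivt hG hF hγ ha hb e1 h
      exact ⟨γ r, Or.inl ⟨r, hr, rfl⟩, hr0⟩
    · rw [hz3] at h
      obtain ⟨r, -, hr, hr0⟩ := geo_ivt hG hF hγ' ha' hb' h e2
      exact ⟨γ' r, Or.inr ⟨r, hr, rfl⟩, hr0⟩
  · rcases le_total 0 (mgExt F (γ b)) with h | h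
    · rw [hz3] at h
      obtain ⟨r, -, hr, hr0⟩ := geo_ivt hG hF hγ' hb' ha' e1 h
      exact ⟨γ' r, Or.inr ⟨r, hr, rfl⟩, hr0⟩
    · obtain ⟨r, -, hr, hr0⟩ := geo_ivt hG hF hγ hb ha h e2
      exact ⟨γ r, Or.inl ⟨r, hr, rfl⟩, hr0⟩

theorem ChainData.hyp_upper (C : ChainData G D) (hG : G.Connected) (hD : 0 ≤ D) : hypDelta G ≤ D := by
  apply Real.sSup_le _ hD
  rintro _ ⟨T, rfl⟩
  apply csInf_le ⟨0, fun d hd => hd.1⟩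
  have c1 := mgDist_comm (T.g1 T.b1) (T.g2 T.a2)
  have c2 := mgDist_comm (T.g2 T.b2) (T.g3 T.a3)
  have c3 := mgDist_comm (T.g3 T.b3) (T.g1 T.a1)
  refine ⟨hD, fun s hs => ?_, fun s hs => ?_, fun s hs => ?_⟩
  · have := connects_two hG T.h2 T.h3 T.glue2 (x := T.g1 T.b1) (y := T.g1 T.a1) T.glue1
      (c3.symm.trans T.glue3)
    obtain ⟨q, ⟨t, ht, rfl⟩ | ⟨t, ht, rfl⟩, hq⟩ := C.core hG T.h1 hs this.symm
    · exact Or.inl ⟨t, ht, hq⟩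
    · exact Or.inr ⟨t, ht, hq⟩
  · have := connects_two hG T.h3 T.h1 T.glue3 (x := T.g2 T.b2) (y := T.g2 T.a2) T.glue2
      (c1.symm.trans T.glue1)
    obtain ⟨q, ⟨t, ht, rfl⟩ | ⟨t, ht, rfl⟩, hq⟩ := C.core hG T.h2 hs this.symm
    · exact Or.inr ⟨t, ht, hq⟩
    · exact Or.inl ⟨t, ht, hq⟩
  · have := connects_two hG T.h1 T.h2 T.glue1 (x := T.g3 T.b3) (y := T.g3 T.a3) T.glue3
      (c2.symm.trans T.glue2)
    obtain ⟨q, ⟨t, ht, rfl⟩ | ⟨t, ht, rfl⟩, hq⟩ := C.core hG T.h3 hs this.symm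
    · exact Or.inl ⟨t, ht, hq⟩
    · exact Or.inr ⟨t, ht, hq⟩

end Chain

open SimpleGraph Set
set_option linter.unusedSectionVars false

section Ladder

/-- comparison as a sign -/
def sg (x y : ℕ) : ℤ := if x < y then -1 else if x = y then 0 else 1

/-- oriented adjacency of the ladder with leaves -/
def LR (N : ℕ) (T U : ℕ → ℕ) (u v : ℕ) : Prop :=
  (u + 1 = v ∧ v ≤ T N) ∨ (T N + 1 ≤ u ∧ u + 1 = v ∧ v ≤ T N + 1 + U N) ∨
  (∃ i ≤ N, u = T i ∧ v = T N + 1 + U i) ∨ (u = 0 ∧ T N + U N + 2 ≤ v)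

/-- separating functions -/
def LF (N : ℕ) (T U : ℕ → ℕ) : ℕ → ℕ → ℤ
  | 0, _ => 1
  | i + 1, m => if m ≤ T N then sg m (T i) else if m ≤ T N + 1 + U N then sg m (T N + 1 + U i) else -1

/-- conditions on the ladder -/
structure Lad (N n : ℕ) (T U : ℕ → ℕ) : Prop where
  hN : 1 ≤ N
  T0 : T 0 = 0
  U0 : U 0 = 0
  hT : StrictMono T
  hU : StrictMono U
  hn : T N + U N + 2 ≤ n

variable {N n : ℕ} {T U : ℕ → ℕ}

theorem Lad.lt_of_LR (h : Lad N n T U) {u v : ℕ} (hr : LR N T U u v) : u < v := by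
  rcases hr with hr | hr | ⟨i, hi, hr⟩ | hr
  · omega
  · omega
  · have := h.hT.monotone hi; omega
  · omega

theorem Lad.LF_adj (h : Lad N n T U) (k : ℕ) {u v : ℕ} (hr : LR N T U u v) :
    |LF N T U k u - LF N T U k v| ≤ 1 := by
  cases k with
  | zero => simp [LF]
  | succ i =>
    rw [abs_le]
    have hT0 := h.T0
    have hTU : ∀ j, T j < T i ∧ U j < U i ∨ T j = T i ∧ U j = U i ∨ T i < T j ∧ U i < U j := by
      intro j
      rcases lt_trichotomy j i with hj | rfl | hj
      · exact Or.inl ⟨h.hT hj, h.hU hj⟩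
      · exact Or.inr (Or.inl ⟨rfl, rfl⟩)
      · exact Or.inr (Or.inr ⟨h.hT hj, h.hU hj⟩)
    rcases hr with hr | hr | ⟨j, hj, hr⟩ | hr
    · simp only [LF, sg]; split_ifs <;> omega
    · simp only [LF, sg]; split_ifs <;> omega
    · have := h.hT.monotone hj
      have := h.hU.monotone hj
      have := hTU j
      simp only [LF, sg]; split_ifs <;> omega
    · simp only [LF, sg]; split_ifs <;> omega

theorem Lad.LF_mono (h : Lad N n T U) (k m : ℕ) : LF N T U (k + 1) m ≤ LF N T U k m := by
  cases k with
  | zero => simp only [LF, sg]; split_ifs <;> omega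
  | succ i =>
    have := h.hT (show i < i + 1 by omega)
    have := h.hU (show i < i + 1 by omega)
    simp only [LF, sg]; split_ifs <;> omega

theorem Lad.LF_last (h : Lad N n T U) (m : ℕ) : LF N T U (N + 1) m ≤ 0 := by
  simp only [LF, sg]; split_ifs <;> omega

theorem Lad.LF_T (h : Lad N n T U) {i : ℕ} (hi : i ≤ N) : LF N T U (i + 1) (T i) = 0 := by
  have := h.hT.monotone hi
  simp only [LF, sg]; split_ifs <;> omega

theorem Lad.LF_U (h : Lad N n T U) {i : ℕ} (hi : i ≤ N) :
    LF N T U (i + 1) (T N + 1 + U i) = 0 := by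
  have := h.hU.monotone hi
  simp only [LF, sg]; split_ifs <;> omega

theorem Lad.LF_zero (h : Lad N n T U) {i m : ℕ} (hm : LF N T U (i + 1) m = 0) :
    m = T i ∨ m = T N + 1 + U i := by
  simp only [LF, sg] at hm; split_ifs at hm <;> omega

/-- length of the polygon between rungs `i` and `j` -/
def pf (T U : ℕ → ℕ) (i j : ℕ) : ℕ := (T j - T i) + (U j - U i) + 2

/-- vertices of the polygon between rungs `i` and `j` -/
def pc (N : ℕ) (T U : ℕ → ℕ) (i j k : ℕ) : ℕ :=
  if k ≤ T j - T i then T i + k else T N + 1 + U j - (k - (T j - T i) - 1)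

theorem Lad.pc_lt (h : Lad N n T U) {i j k : ℕ} (hij : i < j) (hj : j ≤ N) (hk : k < pf T U i j) :
    pc N T U i j k < T N + U N + 2 := by
  have := h.hT hij
  have := h.hU hij
  have := h.hT.monotone hj
  have := h.hU.monotone hj
  unfold pf at hk; unfold pc; split_ifs <;> omega

theorem Lad.pc_inj (h : Lad N n T U) {i j k l : ℕ} (hij : i < j) (hj : j ≤ N)
    (hk : k < pf T U i j) (hl : l < pf T U i j) (e : pc N T U i j k = pc N T U i j l) : k = l := by
  have := h.hT hij
  have := h.hU hij
  have := h.hT.monotone hj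
  have := h.hU.monotone hj
  unfold pf at hk hl; unfold pc at e; split_ifs at e <;> omega

theorem Lad.pc_adj (h : Lad N n T U) {i j k : ℕ} (hij : i < j) (hj : j ≤ N)
    (hk : k + 1 < pf T U i j) : LR N T U (pc N T U i j k) (pc N T U i j (k + 1)) ∨
      LR N T U (pc N T U i j (k + 1)) (pc N T U i j k) := by
  have := h.hT hij
  have := h.hU hij
  have := h.hT.monotone hj
  have := h.hU.monotone hj
  unfold pf at hk
  rcases lt_trichotomy k (T j - T i) with hh | hh | hh
  · left; left
    unfold pc
    rw [if_pos (by omega), if_pos (by omega)]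
    omega
  · left; right; right; left
    refine ⟨j, hj, ?_⟩
    unfold pc
    rw [if_pos (by omega), if_neg (by omega)]
    omega
  · right; right; left
    unfold pc
    rw [if_neg (by omega), if_neg (by omega)]
    omega

theorem Lad.pc_zero (h : Lad N n T U) (i j : ℕ) : pc N T U i j 0 = T i := by simp [pc]

theorem Lad.pc_last (h : Lad N n T U) {i j : ℕ} (hij : i < j) :
    pc N T U i j (pf T U i j - 1) = T N + 1 + U i := by
  have := h.hT hij
  have := h.hU hij
  unfold pc pf
  rw [if_neg (by omega)]
  omega

theorem Lad.pc_a (h : Lad N n T U) {i j : ℕ} (hij : i < j) :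
    pc N T U i j (T j - T i) = T j := by
  have := h.hT hij
  unfold pc; rw [if_pos (by omega)]; omega

theorem Lad.pc_a1 (h : Lad N n T U) {i j : ℕ} (hij : i < j) :
    pc N T U i j (T j - T i + 1) = T N + 1 + U j := by
  unfold pc; rw [if_neg (by omega)]; omega

/-- edges of a bag are edges of the polygon -/
theorem Lad.bag (h : Lad N n T U) {i u v : ℕ} (hi : i + 1 ≤ N) (hr : LR N T U u v)
    (u1 : 0 ≤ LF N T U (i + 1) u) (v1 : 0 ≤ LF N T U (i + 1) v)
    (u2 : LF N T U (i + 2) u ≤ 0) (v2 : LF N T U (i + 2) v ≤ 0) :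
    ∃ k, k < pf T U i (i + 1) ∧
      let c := fun k => pc N T U i (i + 1) (k % pf T U i (i + 1))
      (u = c k ∧ v = c (k + 1)) ∨ (v = c k ∧ u = c (k + 1)) := by
  have a1 := h.hT (Nat.lt_succ_self i)
  have a2 := h.hU (Nat.lt_succ_self i)
  have a3 := h.hT.monotone hi
  have a4 := h.hU.monotone hi
  simp only [Nat.succ_eq_add_one] at a1 a2
  have key : ∀ k, k + 1 < pf T U i (i + 1) → (u = pc N T U i (i + 1) k ∧ v = pc N T U i (i + 1) (k + 1) ∨
      v = pc N T U i (i + 1) k ∧ u = pc N T U i (i + 1) (k + 1)) →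
      ∃ k, k < pf T U i (i + 1) ∧
      let c := fun k => pc N T U i (i + 1) (k % pf T U i (i + 1))
      (u = c k ∧ v = c (k + 1)) ∨ (v = c k ∧ u = c (k + 1)) := by
    intro k hk hh
    refine ⟨k, by omega, ?_⟩
    simp only
    rw [Nat.mod_eq_of_lt hk, Nat.mod_eq_of_lt (by omega : k < _)]
    exact hh
  rcases hr with hr | hr | ⟨j, hj, hr⟩ | hr
  · have b1 : T i ≤ u ∧ v ≤ T (i + 1) := by
      simp only [LF, sg] at u1 v2; split_ifs at u1 v2 <;> omega
    apply key (u - T i)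
    · unfold pf; omega
    · left; unfold pc; rw [if_pos (by omega), if_pos (by omega)]; omega
  · have b1 : T N + 1 + U i ≤ u ∧ v ≤ T N + 1 + U (i + 1) := by
      simp only [LF, sg] at u1 v2; split_ifs at u1 v2 <;> omega
    apply key ((T (i + 1) - T i) + 1 + (T N + 1 + U (i + 1) - v))
    · unfold pf; omega
    · right; unfold pc; rw [if_neg (by omega), if_neg (by omega)]; omega
  · have b0 := h.hT.monotone hj
    have b1 : T i ≤ T j ∧ T j ≤ T (i + 1) := by
      rw [hr.1] at u1 u2
      simp only [LF, sg] at u1 u2; split_ifs at u1 u2 <;> omega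
    have b2 := h.hT.le_iff_le.1 b1.1
    have b3 := h.hT.le_iff_le.1 b1.2
    have b4 : j = i ∨ j = i + 1 := by omega
    rcases b4 with rfl | rfl
    · refine ⟨pf T U j (j + 1) - 1, by unfold pf; omega, ?_⟩
      right
      have hf : pf T U j (j + 1) - 1 + 1 = pf T U j (j + 1) := by unfold pf; omega
      simp only
      rw [hf, Nat.mod_self, Nat.mod_eq_of_lt (by omega), h.pc_last (Nat.lt_succ_self j), h.pc_zero]
      exact ⟨hr.2, hr.1⟩
    · apply key (T (i + 1) - T i)
      · unfold pf; omega
      · left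
        rw [h.pc_a (Nat.lt_succ_self i), h.pc_a1 (Nat.lt_succ_self i)]
        exact hr
  · exfalso
    simp only [LF, sg] at v1; split_ifs at v1 <;> omega

theorem Lad.bag0 (h : Lad N n T U) {u v : ℕ} (hr : LR N T U u v)
    (u2 : LF N T U 1 u ≤ 0) (v2 : LF N T U 1 v ≤ 0) : u = 0 := by
  have h1 := h.T0
  have h2 := h.U0
  rcases hr with hr | hr | ⟨j, hj, hr⟩ | hr
  · simp only [LF, sg] at v2; split_ifs at v2 <;> omega
  · simp only [LF, sg] at v2; split_ifs at v2 <;> omega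
  · have b0 := h.hT.monotone hj
    rw [hr.1] at u2 ⊢
    simp only [LF, sg] at u2; split_ifs at u2 <;> omega
  · exact hr.1

/-- the graph -/
def LG (h : Lad N n T U) : SimpleGraph (Fin n) where
  Adj u v := LR N T U u.1 v.1 ∨ LR N T U v.1 u.1
  symm := ⟨fun u v hh => hh.symm⟩
  loopless := ⟨fun u hh => by
    rcases hh with hh | hh <;> exact absurd (h.lt_of_LR hh) (lt_irrefl _)⟩

/-- vertex with a given label -/
def vx (h : Lad N n T U) (m : ℕ) : Fin n := ⟨m % n, Nat.mod_lt _ (by have := h.hn; omega)⟩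

theorem vx_val (h : Lad N n T U) {m : ℕ} (hm : m < n) : (vx h m).1 = m := Nat.mod_eq_of_lt hm

theorem vx_eq (h : Lad N n T U) {u : Fin n} {m : ℕ} (e : u.1 = m) : u = vx h m := by
  apply Fin.ext; rw [vx_val h (e ▸ u.2)]; exact e

/-- polygon sequence -/
def pseq (h : Lad N n T U) (i j k : ℕ) : Fin n := vx h (pc N T U i j (k % pf T U i j))

theorem pseq_val (h : Lad N n T U) {i j : ℕ} (hij : i < j) (hj : j ≤ N) (k : ℕ) :
    (pseq h i j k).1 = pc N T U i j (k % pf T U i j) := by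
  apply vx_val
  have := h.pc_lt hij hj (Nat.mod_lt k (show 0 < pf T U i j by unfold pf; omega))
  have := h.hn
  omega

theorem pseq_cyc (h : Lad N n T U) {i j : ℕ} (hij : i < j) (hj : j ≤ N) :
    CycSeq (LG h) (pf T U i j) (pseq h i j) := by
  have hf : 2 ≤ pf T U i j := by unfold pf; omega
  refine ⟨fun k => ?_, fun k => ?_, fun k l hkl hl e => ?_⟩
  · have hlt := Nat.mod_lt k (show 0 < pf T U i j by omega)
    show LR N T U _ _ ∨ LR N T U _ _
    rw [pseq_val h hij hj, pseq_val h hij hj]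
    rcases Nat.lt_or_ge (k % pf T U i j + 1) (pf T U i j) with hh | hh
    · have : (k + 1) % pf T U i j = k % pf T U i j + 1 := by
        rw [Nat.add_mod, Nat.mod_eq_of_lt (show 1 < pf T U i j by omega), Nat.mod_eq_of_lt hh]
      rw [this]
      exact h.pc_adj hij hj hh
    · have e : k % pf T U i j = pf T U i j - 1 := by omega
      have : (k + 1) % pf T U i j = 0 := by
        rw [Nat.add_mod, Nat.mod_eq_of_lt (show 1 < pf T U i j by omega), e,
          Nat.sub_add_cancel (by omega), Nat.mod_self]
      rw [this, e, h.pc_zero, h.pc_last hij]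
      right; right; right; left
      exact ⟨i, by omega, rfl, rfl⟩
  · unfold pseq; rw [Nat.add_mod_right]
  · have e' := congrArg Fin.val e
    rw [pseq_val h hij hj, pseq_val h hij hj] at e'
    have := h.pc_inj hij hj (Nat.mod_lt _ (by omega)) (Nat.mod_lt _ (by omega)) e'
    have := Nat.ModEq.symm this
    have h3 := (Nat.modEq_iff_dvd' hkl.le).1 this.symm
    have := Nat.le_of_dvd (by omega) h3
    omega

theorem LG_bag (h : Lad N n T U) {i : ℕ} {u v : Fin n} (hi : i + 1 ≤ N) (hr : (LG h).Adj u v)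
    (u1 : 0 ≤ LF N T U (i + 1) u.1) (v1 : 0 ≤ LF N T U (i + 1) v.1)
    (u2 : LF N T U (i + 2) u.1 ≤ 0) (v2 : LF N T U (i + 2) v.1 ≤ 0) :
    ∃ k, k < pf T U i (i + 1) ∧ ((u = pseq h i (i + 1) k ∧ v = pseq h i (i + 1) (k + 1)) ∨
      (v = pseq h i (i + 1) k ∧ u = pseq h i (i + 1) (k + 1))) := by
  rcases hr with hr | hr
  · obtain ⟨k, hk, hh⟩ := h.bag hi hr u1 v1 u2 v2
    refine ⟨k, hk, ?_⟩
    rcases hh with hh | hh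
    · exact Or.inl ⟨vx_eq h hh.1, vx_eq h hh.2⟩
    · exact Or.inr ⟨vx_eq h hh.1, vx_eq h hh.2⟩
  · obtain ⟨k, hk, hh⟩ := h.bag hi hr v1 u1 v2 u2
    refine ⟨k, hk, ?_⟩
    rcases hh with hh | hh
    · exact Or.inr ⟨vx_eq h hh.1, vx_eq h hh.2⟩
    · exact Or.inl ⟨vx_eq h hh.1, vx_eq h hh.2⟩

theorem LG_connected (h : Lad N n T U) : (LG h).Connected := by
  have hn := h.hn
  have hT0 := h.T0
  have hU0 := h.U0
  have h0 : ∀ m, (hm : m < n) → (LG h).Reachable ⟨0, by omega⟩ ⟨m, hm⟩ := by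
    intro m
    induction m with
    | zero => intro hm; exact Reachable.refl _
    | succ m ih =>
      intro hm
      by_cases h1 : m + 1 ≤ T N
      · exact (ih (by omega)).trans (Adj.reachable (Or.inl (Or.inl ⟨rfl, h1⟩)))
      by_cases h2 : m + 1 = T N + 1
      · exact Adj.reachable (Or.inl (Or.inr (Or.inr (Or.inl
          ⟨0, by omega, by simp [hT0], by simp only [hU0]; omega⟩))))
      by_cases h3 : m + 1 ≤ T N + 1 + U N
      · exact (ih (by omega)).trans (Adj.reachable (Or.inl (Or.inr (Or.inl
          ⟨by simp only; omega, rfl, h3⟩))))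
      · exact Adj.reachable (Or.inl (Or.inr (Or.inr (Or.inr ⟨rfl, by simp only; omega⟩))))
  have : Nonempty (Fin n) := ⟨⟨0, by omega⟩⟩
  refine ⟨fun u v => ((h0 u.1 u.2).symm.trans (h0 v.1 v.2))⟩

/-- a leaf only sees vertex zero -/
theorem LG_leaf (h : Lad N n T U) {u v : Fin n} (hr : (LG h).Adj u v)
    (hu : T N + U N + 2 ≤ u.1) : v.1 = 0 := by
  rcases hr with (hr | hr | ⟨j, hj, hr⟩ | hr) | (hr | hr | ⟨j, hj, hr⟩ | hr)
  all_goals first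
    | omega
    | (have := h.hT.monotone hj; have := h.hU.monotone hj; omega)

theorem LG_bag0 (h : Lad N n T U) {u v : Fin n} (hr : (LG h).Adj u v)
    (u2 : LF N T U 1 u.1 ≤ 0) (v2 : LF N T U 1 v.1 ≤ 0) : u.1 = 0 ∨ v.1 = 0 := by
  rcases hr with hr | hr
  · exact Or.inl (h.bag0 hr u2 v2)
  · exact Or.inr (h.bag0 hr v2 u2)

theorem CycSeq.nbrs {G : SimpleGraph (Fin n)} {L : ℕ} {d : ℕ → Fin n} (hd : CycSeq G L d)
    (hL : 3 ≤ L) (k : ℕ) : ∃ x y, G.Adj (d k) (d x) ∧ G.Adj (d k) (d y) ∧ d x ≠ d y := by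
  refine ⟨k + 1, k + L - 1, hd.1 k, ?_, hd.2.2 _ _ (by omega) (by omega)⟩
  have := hd.1 (k + L - 1)
  rw [Nat.sub_add_cancel (by omega), hd.2.1] at this
  exact this.symm

theorem CycSeq.card_le {G : SimpleGraph (Fin n)} {L : ℕ} {d : ℕ → Fin n} (hd : CycSeq G L d)
    {m : ℕ} (hm : ∀ k, (d k).1 < m) : L ≤ m := by
  have : Set.InjOn (fun k => (d k).1) (Finset.range L : Set ℕ) := by
    intro a ha b hb e
    simp only [Finset.coe_range, Set.mem_Iio] at ha hb
    have e := Fin.ext e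
    rcases lt_trichotomy a b with hh | hh | hh
    · exact absurd e (hd.2.2 _ _ hh (by omega))
    · exact hh
    · exact absurd e.symm (hd.2.2 _ _ hh (by omega))
  have := Finset.card_le_card_of_injOn (s := Finset.range L) (t := Finset.range m) _
    (fun k _ => by simpa using hm k) this
  simpa using this

theorem LG_cyc_le (h : Lad N n T U) {L : ℕ} {d : ℕ → Fin n} (hd : CycSeq (LG h) L d)
    (hL : 3 ≤ L) : L ≤ T N + U N + 2 := by
  apply hd.card_le
  intro k
  by_contra hcon
  obtain ⟨x, y, hx, hy, hne⟩ := hd.nbrs hL k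
  have hx := LG_leaf h hx (by omega)
  have hy := LG_leaf h hy (by omega)
  exact hne (Fin.ext (hx.trans hy.symm))

theorem LG_cyc_ge (h : Lad N n T U) {L g : ℕ} {d : ℕ → Fin n} (hd : CycSeq (LG h) L d)
    (hL : 3 ≤ L) (hg : ∀ i, i + 1 ≤ N → g ≤ pf T U i (i + 1)) : g ≤ L := by
  classical
  have hex : ∃ k, 0 < LF N T U 1 (d k).1 := by
    by_contra hcon
    push Not at hcon
    have : ∃ k, (d k).1 ≠ 0 := by
      by_contra hc2
      push Not at hc2
      exact (hd.1 0).ne (Fin.ext ((hc2 0).trans (hc2 1).symm))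
    obtain ⟨k, hk⟩ := this
    obtain ⟨x, y, hx, hy, hne⟩ := hd.nbrs hL k
    have hx := (LG_bag0 h hx (hcon _) (hcon _)).resolve_left hk
    have hy := (LG_bag0 h hy (hcon _) (hcon _)).resolve_left hk
    exact hne (Fin.ext (hx.trans hy.symm))
  have hmax : ∃ i, i + 1 ≤ N ∧ (∃ k, 0 < LF N T U (i + 1) (d k).1) ∧
      ∀ k, LF N T U (i + 2) (d k).1 ≤ 0 := by
    by_contra hcon
    push Not at hcon
    have : ∀ i, i ≤ N → ∃ k, 0 < LF N T U (i + 1) (d k).1 := by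
      intro i
      induction i with
      | zero => intro _; exact hex
      | succ i ih =>
        intro hi
        obtain ⟨k, hk⟩ := ih (by omega)
        exact hcon i hi ⟨k, hk⟩
    obtain ⟨k, hk⟩ := this N le_rfl
    have := h.LF_last (d k).1
    omega
  obtain ⟨i, hi, ⟨k0, hk0⟩, hle⟩ := hmax
  refine (hg i hi).trans ?_
  set f := pf T U i (i + 1) with hf
  have hii : i < i + 1 := Nat.lt_succ_self i
  have hc := pseq_cyc h hii hi
  rw [← hf] at hc
  set c := pseq h i (i + 1) with hcdef
  have hf2 : 2 ≤ f := by rw [hf]; unfold pf; omega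
  have c0 : LF N T U (i + 1) (c 0).1 = 0 := by
    rw [hcdef, pseq_val h hii hi, Nat.zero_mod, h.pc_zero, h.LF_T (by omega)]
  have c1 : LF N T U (i + 1) (c (f - 1)).1 = 0 := by
    rw [hcdef, pseq_val h hii hi, Nat.mod_eq_of_lt (by omega), hf, h.pc_last hii, h.LF_U (by omega)]
  have cf : c f = c 0 := by have := hc.2.1 0; rwa [zero_add] at this
  -- structure of edges of the cycle near a positive vertex
  have edge : ∀ a x, (LG h).Adj (d a) (d x) → 0 < LF N T U (i + 1) (d a).1 →
      ∃ k, 1 ≤ k ∧ k + 2 ≤ f ∧ d a = c k ∧ (d x = c (k + 1) ∨ d x = c (k - 1)) := by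
    intro a x hax hpos
    have hadj : |LF N T U (i + 1) (d a).1 - LF N T U (i + 1) (d x).1| ≤ 1 := by
      rcases hax with hr | hr
      · exact h.LF_adj _ hr
      · rw [abs_sub_comm]; exact h.LF_adj _ hr
    have hadj := abs_le.1 hadj
    obtain ⟨k, hk, hh⟩ := LG_bag h hi hax hpos.le (by omega) (hle _) (hle _)
    rw [← hf] at hk
    have hne0 : d a ≠ c 0 := by intro e; rw [e] at hpos; omega
    have hne1 : d a ≠ c (f - 1) := by intro e; rw [e] at hpos; omega
    rcases hh with ⟨e1, e2⟩ | ⟨e1, e2⟩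
    · refine ⟨k, ?_, ?_, e1, Or.inl e2⟩
      · by_contra hk0
        have : k = 0 := by omega
        rw [this] at e1; exact hne0 e1
      · by_contra hk0
        have : k = f - 1 := by omega
        rw [this] at e1; exact hne1 e1
    · refine ⟨k + 1, by omega, ?_, e2, Or.inr e1⟩
      by_contra hk0
      have : k + 1 = f - 1 ∨ k + 1 = f := by omega
      rcases this with hk' | hk'
      · rw [← hcdef, hk'] at e2; exact hne1 e2
      · rw [← hcdef, hk', cf] at e2; exact hne0 e2
  have inj : ∀ a b, a < f → b < f → c a = c b → a = b := by
    intro a b ha hb e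
    rcases lt_trichotomy a b with hh | hh | hh
    · exact absurd e (hc.2.2 _ _ hh (by omega))
    · exact hh
    · exact absurd e.symm (hc.2.2 _ _ hh (by omega))
  have cpos : ∀ k, 1 ≤ k → k + 2 ≤ f → ∀ a, d a = c k → 0 < LF N T U (i + 1) (d a).1 := by
    intro k hk1 hk2 a ha
    have hv := congrArg Fin.val ha
    rw [hcdef, pseq_val h hii hi, Nat.mod_eq_of_lt (by omega)] at hv
    rw [hv]
    have a1 := h.hT hii
    have a2 := h.hU hii
    have a3 := h.hT.monotone hi
    have a4 := h.hU.monotone hi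
    have a5 : f = (T (i + 1) - T i) + (U (i + 1) - U i) + 2 := hf
    simp only [pc, LF, sg]
    split_ifs <;> omega
  have step : ∀ k, 1 ≤ k → k + 2 ≤ f → (∃ a, d a = c k) →
      (∃ a, d a = c (k + 1)) ∧ (∃ a, d a = c (k - 1)) := by
    rintro k hk1 hk2 ⟨a, ha⟩
    obtain ⟨x, y, hx, hy, hne⟩ := hd.nbrs hL a
    have hpos := cpos k hk1 hk2 a ha
    obtain ⟨k', p1, p2, p3, p4⟩ := edge a x hx hpos
    obtain ⟨k'', q1, q2, q3, q4⟩ := edge a y hy hpos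
    have e1 := inj k' k (by omega) (by omega) (p3.symm.trans ha)
    have e2 := inj k'' k (by omega) (by omega) (q3.symm.trans ha)
    subst e1 e2
    rcases p4 with p4 | p4 <;> rcases q4 with q4 | q4
    · exact absurd (p4.trans q4.symm) hne
    · exact ⟨⟨_, p4⟩, ⟨_, q4⟩⟩
    · exact ⟨⟨_, q4⟩, ⟨_, p4⟩⟩
    · exact absurd (p4.trans q4.symm) hne
  obtain ⟨x, y, hx, -, -⟩ := hd.nbrs hL k0
  obtain ⟨k, p1, p2, p3, -⟩ := edge k0 x hx hk0
  have up : ∀ m, k ≤ m → m + 1 ≤ f → ∃ a, d a = c m := by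
    intro m hm
    induction m, hm using Nat.le_induction with
    | base => intro _; exact ⟨k0, p3⟩
    | succ m hm ih => intro hm'; exact (step m (by omega) (by omega) (ih (by omega))).1
  have down : ∀ m, m ≤ k → ∃ a, d a = c (k - m) := by
    intro m
    induction m with
    | zero => intro _; exact ⟨k0, p3⟩
    | succ m ih => intro hm'; exact (step (k - m) (by omega) (by omega) (ih (by omega))).2
  have all : ∀ m, m < f → ∃ a, a < L ∧ d a = c m := by
    intro m hm
    have : ∃ a, d a = c m := by
      rcases le_total k m with hh | hh
      · exact up m hh (by omega)
      · have := down (k - m) (by omega)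
        rwa [Nat.sub_sub_self hh] at this
    obtain ⟨a, ha⟩ := this
    refine ⟨a % L, Nat.mod_lt _ (by omega), ?_⟩
    rw [← ha]
    have hper : ∀ q r, d (r + q * L) = d r := by
      intro q r
      induction q with
      | zero => simp
      | succ q ih => rw [Nat.succ_mul, ← add_assoc, hd.2.1, ih]
    conv_rhs => rw [← Nat.mod_add_div' a L]
    rw [hper]
  choose! a ha1 ha2 using all
  have := Finset.card_le_card_of_injOn (s := Finset.range f) (t := Finset.range L) a
    (fun m hm => by simpa using ha1 m (by simpa using hm))
    (by
      intro m hm m' hm' e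
      simp only [Finset.coe_range, Set.mem_Iio] at hm hm'
      apply inj m m' hm hm'
      rw [← ha2 m hm, ← ha2 m' hm', e])
  simpa using this

end Ladder

open SimpleGraph Set
set_option linter.unusedSectionVars false

section LadderHyp
variable {N n : ℕ} {T U : ℕ → ℕ}

theorem LG_point (h : Lad N n T U) {i : ℕ} (hi : i + 1 ≤ N) (p : MGPoint (LG h))
    (u1 : 0 ≤ LF N T U (i + 1) p.1.1.1) (v1 : 0 ≤ LF N T U (i + 1) p.1.2.1.1)
    (u2 : LF N T U (i + 2) p.1.1.1 ≤ 0) (v2 : LF N T U (i + 2) p.1.2.1.1 ≤ 0) :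
    ∃ k t, ∃ ht : t ∈ Icc (0 : ℝ) 1, k < pf T U i (i + 1) ∧
      mgDist (LG h) p (cpt (pseq_cyc h (Nat.lt_succ_self i) hi).1 k t ht) = 0 := by
  have hG := LG_connected h
  obtain ⟨k, hk, ⟨e1, e2⟩ | ⟨e1, e2⟩⟩ := LG_bag h hi p.2.1 u1 v1 u2 v2
  · refine ⟨k, p.1.2.2, p.2.2, hk, mg_zero_of_le hG ?_⟩
    have := mgDist_le_same p (cpt (pseq_cyc h (Nat.lt_succ_self i) hi).1 k p.1.2.2 p.2.2) e1 e2
    simpa [cpt] using this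
  · have ht : 1 - p.1.2.2 ∈ Icc (0 : ℝ) 1 := ⟨by linarith [p.2.2.2], by linarith [p.2.2.1]⟩
    refine ⟨k, 1 - p.1.2.2, ht, hk, mg_zero_of_le hG ?_⟩
    have := mgDist_le_flip p (cpt (pseq_cyc h (Nat.lt_succ_self i) hi).1 k (1 - p.1.2.2) ht) e2 e1
    simpa [cpt] using this

theorem mg_zero_both {G : SimpleGraph (Fin n)} (hG : G.Connected) {p p' q q' : MGPoint G}
    (hp : mgDist G p p' = 0) (hq : mgDist G q q' = 0) : mgDist G p q ≤ mgDist G p' q' := by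
  have h1 := mgDist_tri hG p p' q
  have h2 := mgDist_tri hG p' q' q
  rw [mgDist_comm q' q] at h2
  linarith

theorem LG_diam0 (h : Lad N n T U) (p q : MGPoint (LG h))
    (hp : p.1.1.1 = 0 ∨ p.1.2.1.1 = 0) (hq : q.1.1.1 = 0 ∨ q.1.2.1.1 = 0) :
    mgDist (LG h) p q ≤ 2 := by
  have p0 := p.2.2.1
  have p1 := p.2.2.2
  have q0 := q.2.2.1
  have q1 := q.2.2.2
  have hv : ∀ v : Fin n, v.1 = 0 → mgVDist (LG h) v q ≤ 1 := by
    intro v hv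
    rcases hq with hq | hq
    · have := mgVDist_le_u v q
      have e : v = q.1.1 := Fin.ext (hv.trans hq.symm)
      rw [← e, SimpleGraph.dist_self] at this
      push_cast at this
      linarith
    · have := mgVDist_le_v v q
      have e : v = q.1.2.1 := Fin.ext (hv.trans hq.symm)
      rw [← e, SimpleGraph.dist_self] at this
      push_cast at this
      linarith
  rcases hp with hp | hp
  · have := mgDist_le_u p q
    have := hv _ hp
    linarith
  · have := mgDist_le_v p q
    have := hv _ hp
    linarith

theorem LG_mid (h : Lad N n T U) {D : ℝ} (hD : 3 / 2 ≤ D)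
    (ha : ∀ i, i + 1 ≤ N → ((T (i + 1) - T i : ℕ) : ℝ) + 2 ≤ 2 * D)
    (hb : ∀ i, i + 1 ≤ N → ((U (i + 1) - U i : ℕ) : ℝ) + 2 ≤ 2 * D)
    {i : ℕ} (hi : i + 1 ≤ N) (p q q' : MGPoint (LG h))
    (u1 : 0 ≤ LF N T U (i + 1) p.1.1.1) (v1 : 0 ≤ LF N T U (i + 1) p.1.2.1.1)
    (u2 : LF N T U (i + 2) p.1.1.1 ≤ 0) (v2 : LF N T U (i + 2) p.1.2.1.1 ≤ 0)
    (e1 : q.1.1 = vx h (T i)) (e2 : q.1.2.1 = vx h (T N + 1 + U i))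
    (e3 : q'.1.1 = vx h (T (i + 1))) (e4 : q'.1.2.1 = vx h (T N + 1 + U (i + 1))) :
    mgDist (LG h) p q ≤ D ∨ mgDist (LG h) p q' ≤ D := by
  have hG := LG_connected h
  have hii := Nat.lt_succ_self i
  obtain ⟨k, t, ht, hk, hp⟩ := LG_point h hi p u1 v1 u2 v2
  have ha := ha i hi
  have hb := hb i hi
  set f := pf T U i (i + 1) with hf
  have hc := pseq_cyc h hii hi
  set a := T (i + 1) - T i with hadef
  set b := U (i + 1) - U i with hbdef
  have hfab : f = a + b + 2 := rfl
  have hfR : (f : ℝ) = a + b + 2 := by rw [hfab]; push_cast; ring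
  have hq1 : 1 - q.1.2.2 ∈ Icc (0 : ℝ) 1 := ⟨by linarith [q.2.2.2], by linarith [q.2.2.1]⟩
  have hq2 : mgDist (LG h) q (cpt hc.1 (f - 1) (1 - q.1.2.2) hq1) = 0 := by
    apply mg_zero_of_le hG
    have x1 : pseq h i (i + 1) (f - 1) = vx h (T N + 1 + U i) := by
      unfold pseq
      rw [← hf, Nat.mod_eq_of_lt (by omega), hf, h.pc_last hii]
    have x2 : pseq h i (i + 1) (f - 1 + 1) = vx h (T i) := by
      unfold pseq
      rw [← hf, Nat.sub_add_cancel (by omega), Nat.mod_self, h.pc_zero]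
    have := mgDist_le_flip q (cpt hc.1 (f - 1) (1 - q.1.2.2) hq1) (e1.trans x2.symm)
      (e2.trans x1.symm)
    simpa [cpt] using this
  have hq2' : mgDist (LG h) q' (cpt hc.1 a q'.1.2.2 q'.2.2) = 0 := by
    apply mg_zero_of_le hG
    have x1 : pseq h i (i + 1) a = vx h (T (i + 1)) := by
      unfold pseq
      rw [← hf, Nat.mod_eq_of_lt (by omega), h.pc_a hii]
    have x2 : pseq h i (i + 1) (a + 1) = vx h (T N + 1 + U (i + 1)) := by
      unfold pseq
      rw [← hf, Nat.mod_eq_of_lt (by omega), h.pc_a1 hii]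
    have := mgDist_le_same q' (cpt hc.1 a q'.1.2.2 q'.2.2) (e3.trans x1.symm)
      (e4.trans x2.symm)
    simpa [cpt] using this
  have d1 := (mg_zero_both hG hp hq2).trans (cpt_dist_le hc.1 ht hq1)
  have d2 := (mg_zero_both hG hp hq2).trans (cpt_dist_le' hc ht hq1)
  have d3 := (mg_zero_both hG hp hq2').trans (cpt_dist_le hc.1 ht q'.2.2)
  have hf1 : ((f - 1 : ℕ) : ℝ) = a + b + 1 := by
    have : f - 1 = a + b + 1 := by omega
    rw [this]; push_cast; ring
  have y1 := q.2.2.1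
  have y2 := q.2.2.2
  have y3 := q'.2.2.1
  have y4 := q'.2.2.2
  have z1 := ht.1
  have z2 := ht.2
  rw [hf1] at d1 d2
  rw [← hf, hfR] at d2
  rcases lt_trichotomy k a with hka | hka | hka
  · have hka' : (k : ℝ) + 1 ≤ a := by exact_mod_cast hka
    have hk0 : (0 : ℝ) ≤ k := by positivity
    rw [abs_of_nonneg (by linarith)] at d2
    rw [abs_of_nonpos (by linarith)] at d3
    by_contra hcon
    push Not at hcon
    linarith
  · right
    rw [hka] at d3
    refine d3.trans ((abs_le.2 ⟨?_, ?_⟩ : |_| ≤ (1 : ℝ)).trans (by linarith)) <;> linarith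
  · have hka' : (a : ℝ) + 1 ≤ k := by exact_mod_cast hka
    rcases Nat.lt_or_ge k (a + b + 1) with hkb | hkb
    · have hkb' : (k : ℝ) + 1 ≤ a + b + 1 := by exact_mod_cast hkb
      rw [abs_of_nonpos (by linarith)] at d1
      rw [abs_of_nonneg (by linarith)] at d3
      by_contra hcon
      push Not at hcon
      linarith
    · left
      have hkk : k = a + b + 1 := by omega
      rw [hkk] at d1
      push_cast at d1
      refine d1.trans ((abs_le.2 ⟨?_, ?_⟩ : |_| ≤ (1 : ℝ)).trans (by linarith)) <;> linarith

/-- chain decomposition of the ladder -/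
noncomputable def LG_chain (h : Lad N n T U) {D : ℝ} (hD : 3 / 2 ≤ D)
    (ha : ∀ i, i + 1 ≤ N → ((T (i + 1) - T i : ℕ) : ℝ) + 2 ≤ 2 * D)
    (hb : ∀ i, i + 1 ≤ N → ((U (i + 1) - U i : ℕ) : ℝ) + 2 ≤ 2 * D)
    (hf : ∀ i, i + 1 ≤ N → ((pf T U i (i + 1) : ℕ) : ℝ) / 2 ≤ 2 * D - 1) :
    ChainData (LG h) D where
  M := N
  F := fun k v => LF N T U k v.1
  t := fun k => vx h (T (k - 1))
  b := fun k => vx h (T N + 1 + U (k - 1))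
  adj := by
    intro k u v hr
    rcases hr with hr | hr
    · exact h.LF_adj _ hr
    · rw [abs_sub_comm]; exact h.LF_adj _ hr
  mono := fun k v => h.LF_mono k v.1
  zero := fun v => by simp [LF]
  last := fun v => h.LF_last v.1
  rung := by
    intro k h1 h2
    have := h.hT.monotone (show k - 1 ≤ N by omega)
    have := h.hU.monotone (show k - 1 ≤ N by omega)
    have := h.hn
    left; right; right; left
    refine ⟨k - 1, by omega, ?_, ?_⟩ <;> rw [vx_val h (by omega)]
  Ft := by
    intro k h1 h2
    obtain ⟨i, rfl⟩ := Nat.exists_eq_add_of_le' h1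
    have := h.hT.monotone (show i ≤ N by omega)
    have := h.hn
    simp only [Nat.add_sub_cancel]
    rw [vx_val h (by omega), h.LF_T (by omega)]
  Fb := by
    intro k h1 h2
    obtain ⟨i, rfl⟩ := Nat.exists_eq_add_of_le' h1
    have := h.hU.monotone (show i ≤ N by omega)
    have := h.hn
    simp only [Nat.add_sub_cancel]
    rw [vx_val h (by omega), h.LF_U (by omega)]
  Fz := by
    intro k h1 h2 v hv
    obtain ⟨i, rfl⟩ := Nat.exists_eq_add_of_le' h1
    simp only [Nat.add_sub_cancel]
    rcases h.LF_zero hv with e | e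
    · exact Or.inl (vx_eq h e)
    · exact Or.inr (vx_eq h e)
  diam := by
    intro k hk p q p1 p2 p3 p4 q1 q2 q3 q4
    cases k with
    | zero =>
      have := LG_diam0 h p q (LG_bag0 h p.2.1 p3 p4) (LG_bag0 h q.2.1 q3 q4)
      linarith
    | succ i =>
      obtain ⟨k, t, ht, hk1, e1⟩ := LG_point h hk p p1 p2 p3 p4
      obtain ⟨l, s, hs, hl1, e2⟩ := LG_point h hk q q1 q2 q3 q4
      exact (mg_zero_both (LG_connected h) e1 e2).trans
        ((cpt_diam (pseq_cyc h (Nat.lt_succ_self i) hk) hk1 hl1 ht hs).trans (hf i hk))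
  mid := by
    intro k h1 h2 p q q' p1 p2 p3 p4 e1 e2 e3 e4
    obtain ⟨i, rfl⟩ := Nat.exists_eq_add_of_le' h1
    exact LG_mid h hD ha hb (by omega) p q q' p1 p2 p3 p4 e1 e2 e3 e4

theorem LG_mem (h : Lad N n T U) {g c : ℕ} (hg3 : 3 ≤ g) (hc : T N + U N + 2 = c)
    (hg : ∀ i, i + 1 ≤ N → g ≤ pf T U i (i + 1)) (hlast : ∃ i, i + 1 ≤ N ∧ pf T U i (i + 1) = g) :
    memGclass g c (LG h) := by
  have hN := h.hN
  refine ⟨LG_connected h, ?_, ?_⟩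
  · obtain ⟨i, hi, e⟩ := hlast
    have hcyc := pseq_cyc h (Nat.lt_succ_self i) hi
    obtain ⟨a, w, hw, hwl⟩ := hcyc.cycle (by rw [Nat.succ_eq_add_one, e]; exact hg3)
    apply le_antisymm
    · have := hw.girth_le_length
      rw [hwl] at this
      exact this.trans e.le
    · have hac : ¬ (LG h).IsAcyclic := fun hh => hh w hw
      obtain ⟨a', w', hw', hwl'⟩ := exists_girth_eq_length.2 hac
      obtain ⟨d, hd⟩ := cycle_seq hw'
      rw [hwl']
      exact LG_cyc_ge h hd hw'.three_le_length hg
  · have hle : ∀ m ∈ {m : ℕ | ∃ (a : Fin n) (w : (LG h).Walk a a), w.IsCycle ∧ w.length = m},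
        m ≤ c := by
      rintro m ⟨a, w, hw, rfl⟩
      obtain ⟨d, hd⟩ := cycle_seq hw
      rw [← hc]
      exact LG_cyc_le h hd hw.three_le_length
    have hcyc := pseq_cyc h (show 0 < N by omega) le_rfl
    have hp : pf T U 0 N = c := by unfold pf; rw [h.T0, h.U0]; omega
    have hTN := h.hT (show 0 < N by omega)
    obtain ⟨a, w, hw, hwl⟩ := hcyc.cycle (by rw [hp]; omega)
    rw [hp] at hwl
    apply le_antisymm
    · exact csSup_le ⟨c, a, w, hw, hwl⟩ hle
    · exact le_csSup ⟨c, hle⟩ ⟨a, w, hw, hwl⟩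

theorem Agcn_le_ladder (h : Lad N n T U) {g c : ℕ} {D : ℝ} (hg3 : 3 ≤ g) (hc : T N + U N + 2 = c)
    (hg : ∀ i, i + 1 ≤ N → g ≤ pf T U i (i + 1)) (hlast : ∃ i, i + 1 ≤ N ∧ pf T U i (i + 1) = g)
    (hD : 3 / 2 ≤ D)
    (ha : ∀ i, i + 1 ≤ N → ((T (i + 1) - T i : ℕ) : ℝ) + 2 ≤ 2 * D)
    (hb : ∀ i, i + 1 ≤ N → ((U (i + 1) - U i : ℕ) : ℝ) + 2 ≤ 2 * D)
    (hf : ∀ i, i + 1 ≤ N → ((pf T U i (i + 1) : ℕ) : ℝ) / 2 ≤ 2 * D - 1) :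
    Agcn g c n ≤ D := by
  have hmem : hypDelta (LG h) ∈
      {d : ℝ | ∃ G : SimpleGraph (Fin n), memGclass g c G ∧ d = hypDelta G} :=
    ⟨LG h, LG_mem h hg3 hc hg hlast, rfl⟩
  refine (csInf_le ?_ hmem).trans
    ((LG_chain h hD ha hb hf).hyp_upper (LG_connected h) (by linarith))
  refine ⟨g / 4, ?_⟩
  rintro _ ⟨G, hG, rfl⟩
  exact hyp_lower hG.1 hg3 hG.2.1

theorem Agcn_ge {g c n : ℕ} (hg3 : 3 ≤ g) (hadm : ∃ G : SimpleGraph (Fin n), memGclass g c G) :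
    (g : ℝ) / 4 ≤ Agcn g c n := by
  obtain ⟨G, hG⟩ := hadm
  have hne : {d : ℝ | ∃ G : SimpleGraph (Fin n), memGclass g c G ∧ d = hypDelta G}.Nonempty :=
    ⟨hypDelta G, G, hG, rfl⟩
  apply le_csInf hne
  rintro _ ⟨G, hG, rfl⟩
  exact hyp_lower hG.1 hg3 hG.2.1

/-- rung positions -/
def pos (a x i : ℕ) : ℕ := i * a + min i x

theorem pos_succ (a x i : ℕ) : pos a x (i + 1) = pos a x i + a + (if i < x then 1 else 0) := by
  unfold pos
  rw [Nat.succ_mul]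
  split_ifs <;> omega

theorem Agcn_le {g c n : ℕ} {D : ℝ} (hg : 5 ≤ g) (hcn : c ≤ n) (hc : g ^ 2 - 2 * g + 4 ≤ 2 * c)
    (hD : ((g - 2 + 1) / 2 + 1 : ℕ) + 2 ≤ 2 * D) (hD2 : ((g : ℝ) + 2) / 2 ≤ 2 * D - 1) :
    Agcn g c n ≤ D := by
  obtain ⟨N, hN⟩ : ∃ N, N = (c - 2) / (g - 2) := ⟨_, rfl⟩
  obtain ⟨j, hj⟩ : ∃ j, j = (c - 2) % (g - 2) := ⟨_, rfl⟩
  have hjlt : j < g - 2 := by rw [hj]; exact Nat.mod_lt _ (by omega)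
  have hdm : N * (g - 2) + j = c - 2 := by rw [hN, hj]; exact Nat.div_add_mod' _ _
  have hgg : g ^ 2 - 2 * g = g * (g - 2) := by
    rw [pow_two, Nat.mul_sub, Nat.mul_comm 2 g]
  rw [hgg] at hc
  have hc2 : g * (g - 2) ≤ 2 * (c - 2) := by omega
  have hNg : g / 2 ≤ N := by
    rw [hN, Nat.le_div_iff_mul_le (by omega)]
    have : 2 * (g / 2) * (g - 2) ≤ g * (g - 2) := Nat.mul_le_mul_right _ (by omega)
    have : 2 * (g / 2 * (g - 2)) = 2 * (g / 2) * (g - 2) := by ring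
    omega
  have hc5 : 2 ≤ c := by
    have : 5 * 3 ≤ g * (g - 2) := Nat.mul_le_mul hg (by omega)
    omega
  obtain ⟨a, ha⟩ : ∃ a, a = (g - 2) / 2 := ⟨_, rfl⟩
  obtain ⟨b, hb⟩ : ∃ b, b = (g - 2 + 1) / 2 := ⟨_, rfl⟩
  obtain ⟨x, hx⟩ : ∃ x, x = (j + 1) / 2 := ⟨_, rfl⟩
  obtain ⟨y, hy⟩ : ∃ y, y = j / 2 := ⟨_, rfl⟩
  have hab : a + b = g - 2 := by omega
  have hxN : x + 1 ≤ N := by omega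
  have hyN : y + 1 ≤ N := by omega
  have hsum : pos a x N + pos b y N + 2 = c := by
    unfold pos
    rw [min_eq_right (by omega), min_eq_right (by omega)]
    have : N * a + N * b = N * (g - 2) := by rw [← Nat.mul_add, hab]
    omega
  have hlad : Lad N n (pos a x) (pos b y) := by
    refine ⟨by omega, by simp [pos], by simp [pos], strictMono_nat_of_lt_succ fun i => ?_,
      strictMono_nat_of_lt_succ fun i => ?_, by omega⟩ <;> rw [pos_succ] <;> omega
  have hDa : ((b + 1 : ℕ) : ℝ) + 2 ≤ 2 * D := by rw [hb]; exact hD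
  have hpf : ∀ i, g ≤ pf (pos a x) (pos b y) i (i + 1) ∧
      pf (pos a x) (pos b y) i (i + 1) ≤ g + 2 := by
    intro i
    unfold pf
    rw [pos_succ, pos_succ]
    split_ifs <;> omega
  refine Agcn_le_ladder hlad (by omega) hsum (fun i _ => (hpf i).1) ⟨N - 1, by omega, ?_⟩ ?_
    (fun i _ => ?_) (fun i _ => ?_) (fun i _ => ?_)
  · unfold pf
    rw [pos_succ, pos_succ, if_neg (by omega), if_neg (by omega)]
    omega
  · have : (5 : ℝ) ≤ g := by exact_mod_cast hg
    linarith
  · refine le_trans ?_ hDa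
    have : pos a x (i + 1) - pos a x i ≤ b + 1 := by rw [pos_succ]; split_ifs <;> omega
    have : ((pos a x (i + 1) - pos a x i : ℕ) : ℝ) ≤ (b + 1 : ℕ) := by exact_mod_cast this
    linarith
  · refine le_trans ?_ hDa
    have : pos b y (i + 1) - pos b y i ≤ b + 1 := by rw [pos_succ]; split_ifs <;> omega
    have : ((pos b y (i + 1) - pos b y i : ℕ) : ℝ) ≤ (b + 1 : ℕ) := by exact_mod_cast this
    linarith
  · refine le_trans ?_ hD2
    have : ((pf (pos a x) (pos b y) i (i + 1) : ℕ) : ℝ) ≤ (g + 2 : ℕ) := by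
      exact_mod_cast (hpf i).2
    push_cast at this
    linarith

end LadderHyp

/-- Theorem (cotaA2): improved bounds for `A(g,c,n)` when `2c ≥ g² - 2g + 4`,
for v-admissible triplets with `g ≥ 5`. -/
theorem Agcn_bounds'' (g c n : ℕ) (hg : 5 ≤ g) (hgc : g ≤ c) (hcn : c ≤ n)
    (hadm : ∃ G : SimpleGraph (Fin n), memGclass g c G)
    (hc : g ^ 2 - 2 * g + 4 ≤ 2 * c) :
    (Even g → (g : ℝ) / 4 ≤ Agcn g c n ∧ Agcn g c n ≤ ((g : ℝ) + 4) / 4) ∧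
    (Odd g → (g : ℝ) / 4 ≤ Agcn g c n ∧ Agcn g c n ≤ ((g : ℝ) + 5) / 4) := by
  have hlow := Agcn_ge (by omega) hadm
  refine ⟨fun he => ⟨hlow, ?_⟩, fun ho => ⟨hlow, ?_⟩⟩
  · obtain ⟨m, hm⟩ := he
    have e : (g - 2 + 1) / 2 + 1 = m := by omega
    have hgR : (g : ℝ) = m + m := by exact_mod_cast hm
    refine Agcn_le hg hcn hc ?_ ?_
    · rw [e, hgR]; linarith
    · linarith
  · obtain ⟨m, hm⟩ := ho
    have e : (g - 2 + 1) / 2 + 1 = m + 1 := by omega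
    have hgR : (g : ℝ) = 2 * m + 1 := by exact_mod_cast hm
    refine Agcn_le hg hcn hc ?_ ?_
    · rw [e, hgR]; push_cast; linarith
    · linarith
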